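/- arXiv:1002.4664 — 4 statements merged into one kernel-verified Lean document; each statement's English description precedes it below -/
import Mathlib

section
/- Let u : ℝⁿ → [0,∞] be a Borel measurable function with 0 < u(x) < ∞ for σ-almost every x, and suppose that u(x) ≥ C₀·𝒩u(x) for σ-almost every x ∈ ℝⁿ, where C₀ > 0 is a constant. Then there exists a constant C > 0, depending only on α, s, n and C₀, such that σ(E) ≤ C·cap_{α,s}(E) for every compact set E ⊂ ℝⁿ. -/
open MeasureTheory Metric Set Filter
open scoped ENNReal NNReal Topology

noncomputable section

/-- `n`-dimensional Euclidean space. -/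
abbrev En (n : ℕ) : Type := EuclideanSpace ℝ (Fin n)

/-- The truncated Wolff potential
`W^ρ_{α,s} μ (x) = ∫_0^ρ (μ(B(x,r))/r^{n-αs})^{1/(s-1)} dr/r`. -/
noncomputable def wolffT (n : ℕ) (α s : ℝ) (μ : Measure (En n)) (ρ : ℝ) (x : En n) : ℝ≥0∞ :=
  ∫⁻ r in Set.Ioo (0:ℝ) ρ,
    (μ (Metric.ball x r) / ENNReal.ofReal (r ^ ((n:ℝ) - α * s))) ^ (1/(s-1))
      * ENNReal.ofReal r⁻¹

/-- The (full) Wolff potential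
`W_{α,s} μ (x) = ∫_0^∞ (μ(B(x,r))/r^{n-αs})^{1/(s-1)} dr/r`. -/
noncomputable def wolff (n : ℕ) (α s : ℝ) (μ : Measure (En n)) (x : En n) : ℝ≥0∞ :=
  ∫⁻ r in Set.Ioi (0:ℝ),
    (μ (Metric.ball x r) / ENNReal.ofReal (r ^ ((n:ℝ) - α * s))) ^ (1/(s-1))
      * ENNReal.ofReal r⁻¹

/-- The truncated Riesz-type potential
`I^ρ μ (x) = ∫_0^ρ (μ(B(x,r))/r^{n-αs}) dr/r`. -/
noncomputable def rieszT (n : ℕ) (α s : ℝ) (μ : Measure (En n)) (ρ : ℝ) (x : En n) : ℝ≥0∞ :=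
  ∫⁻ r in Set.Ioo (0:ℝ) ρ,
    (μ (Metric.ball x r) / ENNReal.ofReal (r ^ ((n:ℝ) - α * s))) * ENNReal.ofReal r⁻¹

/-- The nonlinear operator `𝒩 f (x) = W_{α,s}(f^{s-1} dσ)(x)`. -/
noncomputable def Nop (n : ℕ) (α s : ℝ) (σ : Measure (En n)) (f : En n → ℝ≥0∞) (x : En n) :
    ℝ≥0∞ :=
  ∫⁻ r in Set.Ioi (0:ℝ),
    (ENNReal.ofReal (r ^ (α * s - (n:ℝ))) * ∫⁻ y in Metric.ball x r, (f y) ^ (s-1) ∂σ)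
        ^ (1/(s-1))
      * ENNReal.ofReal r⁻¹

/-- The Riesz potential `I_α f (x) = (n-α)⁻¹ ∫ f(y) |x-y|^{α-n} dy`. -/
noncomputable def rieszPot (n : ℕ) (α : ℝ) (f : En n → ℝ≥0∞) (x : En n) : ℝ≥0∞ :=
  ENNReal.ofReal (((n:ℝ) - α)⁻¹) * ∫⁻ y, f y * ENNReal.ofReal (‖x - y‖ ^ (α - (n:ℝ)))

/-- The Riesz capacity `cap_{α,s}(A) = inf { ∫ f^s : f ≥ 0, I_α f ≥ 1 on A }`. -/
noncomputable def rieszCap (n : ℕ) (α s : ℝ) (A : Set (En n)) : ℝ≥0∞ :=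
  ⨅ (f : En n → ℝ≥0∞) (_ : Measurable f) (_ : ∀ x ∈ A, 1 ≤ rieszPot n α f x),
    ∫⁻ y, (f y) ^ s

/-- Extended exponential: `eexp x = exp x` for finite `x`, with `eexp ∞ = ∞`. -/
noncomputable def eexp (x : ℝ≥0∞) : ℝ≥0∞ :=
  if x = ∞ then ∞ else ENNReal.ofReal (Real.exp x.toReal)

/-- A quantitative form of the convexity inequality `b ^ s + s b ^ (s - 1) (a - b) ≤ a ^ s`. -/
lemma exists_convexity_gain {s θ : ℝ} (hs : 1 < s) (hθ : 1 < θ) :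
    ∃ c : ℝ, 0 < c ∧ ∀ a b : ℝ, 0 ≤ a → 0 ≤ b →
      c * (max (a - θ * b) 0) ^ s + (b ^ s + s * (b ^ (s - 1) * a)) ≤ a ^ s + s * b ^ s := by
  have hθ0 : 0 < θ := by linarith
  have hs0 : 0 < s := by linarith
  have hcont : ContinuousOn (fun x : ℝ => 1 - s * x ^ (s - 1) + (s - 1) * x ^ s)
      (Icc 0 θ⁻¹) := by
    have h1 : Continuous fun x : ℝ => x ^ (s - 1) := Real.continuous_rpow_const (by linarith)
    have h2 : Continuous fun x : ℝ => x ^ s := Real.continuous_rpow_const (by linarith)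
    exact (by fun_prop : Continuous fun x : ℝ =>
      1 - s * x ^ (s - 1) + (s - 1) * x ^ s).continuousOn
  obtain ⟨x₀, hx₀, hmin⟩ := isCompact_Icc.exists_isMinOn
    (nonempty_Icc.2 (inv_nonneg.2 hθ0.le)) hcont
  have hpos : ∀ x ∈ Icc 0 θ⁻¹, 0 < 1 - s * x ^ (s - 1) + (s - 1) * x ^ s := by
    rintro x ⟨hx0, hx1⟩
    rcases hx0.eq_or_lt with rfl | hx0
    · rw [Real.zero_rpow (by linarith), Real.zero_rpow (by linarith)]; norm_num
    have hx1' : x < 1 := hx1.trans_lt (inv_lt_one_of_one_lt₀ hθ)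
    have ht : 1 < x⁻¹ := (one_lt_inv₀ hx0).2 hx1'
    have hB := one_add_mul_self_lt_rpow_one_add (s := x⁻¹ - 1) (by linarith)
      (by linarith) hs
    rw [show 1 + (x⁻¹ - 1) = x⁻¹ by ring, Real.inv_rpow hx0.le] at hB
    have hxs : 0 < x ^ s := Real.rpow_pos_of_pos hx0 s
    have := mul_lt_mul_of_pos_right hB hxs
    rw [inv_mul_cancel₀ hxs.ne'] at this
    have e : x ^ (s - 1) = x ^ s * x⁻¹ := by
      rw [Real.rpow_sub_one hx0.ne', div_eq_mul_inv]
    rw [e]; linarith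
  refine ⟨_, hpos x₀ hx₀, fun a b ha hb => ?_⟩
  set c := 1 - s * x₀ ^ (s - 1) + (s - 1) * x₀ ^ s
  have hc : 0 < c := hpos x₀ hx₀
  rcases le_or_gt a (θ * b) with h | h
  · rw [max_eq_right (by linarith), Real.zero_rpow (by linarith), mul_zero, zero_add]
    rcases hb.eq_or_lt with rfl | hb
    · rw [Real.zero_rpow (by linarith), Real.zero_rpow (by linarith)]
      have := Real.rpow_nonneg ha s
      simpa
    have hB := one_add_mul_self_le_rpow_one_add (s := a / b - 1)
      (by linarith [div_nonneg ha hb.le]) hs.le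
    rw [show 1 + (a / b - 1) = a / b by ring, Real.div_rpow ha hb.le] at hB
    have hbs : 0 < b ^ s := Real.rpow_pos_of_pos hb s
    have := mul_le_mul_of_nonneg_right hB hbs.le
    rw [div_mul_cancel₀ _ hbs.ne'] at this
    rw [Real.rpow_sub_one hb.ne']
    have e : b ^ s / b * a = a / b * b ^ s := by ring
    rw [e]; linarith
  · have ha' : 0 < a := lt_of_le_of_lt (by positivity) h
    rw [max_eq_left (by linarith)]
    have h1 : (a - θ * b) ^ s ≤ a ^ s :=
      Real.rpow_le_rpow (by linarith) (by nlinarith) hs0.le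
    have hx : b / a ∈ Icc 0 θ⁻¹ := by
      refine ⟨by positivity, ?_⟩
      rw [div_le_iff₀ ha', inv_mul_eq_div, le_div_iff₀ hθ0]; linarith
    have h2 : c ≤ 1 - s * (b / a) ^ (s - 1) + (s - 1) * (b / a) ^ s := hmin hx
    have has : 0 < a ^ s := Real.rpow_pos_of_pos ha' s
    have h3 := mul_le_mul_of_nonneg_right h2 has.le
    have e1 : (b / a) ^ s * a ^ s = b ^ s := by
      rw [Real.div_rpow hb ha, div_mul_cancel₀ _ has.ne']
    have e2 : (b / a) ^ (s - 1) * a ^ s = b ^ (s - 1) * a := by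
      rw [Real.div_rpow hb ha, Real.rpow_sub_one ha'.ne' s]
      field_simp
    have h4 : (1 - s * (b / a) ^ (s - 1) + (s - 1) * (b / a) ^ s) * a ^ s
        = a ^ s - s * (b ^ (s - 1) * a) + (s - 1) * b ^ s := by
      rw [← e1, ← e2]; ring
    have h5 := mul_le_mul_of_nonneg_left h1 hc.le
    nlinarith

lemma ENNReal.exists_convexity_gain {s θ : ℝ} (hs : 1 < s) (hθ : 1 < θ) :
    ∃ c : ℝ, 0 < c ∧ ∀ a b : ℝ≥0∞,
      ENNReal.ofReal c * (a - ENNReal.ofReal θ * b) ^ s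
        + (b ^ s + ENNReal.ofReal s * (b ^ (s - 1) * a)) ≤ a ^ s + ENNReal.ofReal s * b ^ s := by
  obtain ⟨c, hc, h⟩ := _root_.exists_convexity_gain hs hθ
  refine ⟨c, hc, fun a b => ?_⟩
  have hs0 : 0 < s := by linarith
  by_cases ha : a = ∞
  · simp [ha, ENNReal.top_rpow_of_pos hs0]
  by_cases hb : b = ∞
  · have : ENNReal.ofReal s * b ^ s = ∞ := by
      rw [hb, ENNReal.top_rpow_of_pos hs0, ENNReal.mul_top (by simpa using hs0)]
    rw [this, add_top]
    exact le_top
  lift a to ℝ≥0 using ha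
  lift b to ℝ≥0 using hb
  have ha0 : 0 ≤ (a : ℝ) := a.coe_nonneg
  have hb0 : 0 ≤ (b : ℝ) := b.coe_nonneg
  have := ENNReal.ofReal_le_ofReal (h a b ha0 hb0)
  have hθ0 : 0 ≤ θ := by linarith
  have key : (a : ℝ≥0∞) - ENNReal.ofReal θ * b = ENNReal.ofReal (max ((a : ℝ) - θ * b) 0) := by
    rw [← ENNReal.ofReal_coe_nnreal (p := a), ← ENNReal.ofReal_coe_nnreal (p := b),
      ← ENNReal.ofReal_mul hθ0, ← ENNReal.ofReal_sub _ (by positivity)]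
    rcases le_total ((a : ℝ) - θ * b) 0 with h | h
    · rw [max_eq_right h, ENNReal.ofReal_of_nonpos h, ENNReal.ofReal_zero]
    · rw [max_eq_left h]
  rw [key, ENNReal.ofReal_rpow_of_nonneg (le_max_right _ _) hs0.le,
    ← ENNReal.ofReal_coe_nnreal (p := a), ← ENNReal.ofReal_coe_nnreal (p := b),
    ENNReal.ofReal_rpow_of_nonneg ha0 hs0.le, ENNReal.ofReal_rpow_of_nonneg hb0 hs0.le,
    ENNReal.ofReal_rpow_of_nonneg hb0 (by linarith),
    ← ENNReal.ofReal_mul (Real.rpow_nonneg hb0 _), ← ENNReal.ofReal_mul hs0.le,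
    ← ENNReal.ofReal_mul hs0.le, ← ENNReal.ofReal_mul hc.le,
    ← ENNReal.ofReal_add (Real.rpow_nonneg hb0 _)
      (mul_nonneg hs0.le (mul_nonneg (Real.rpow_nonneg hb0 _) ha0)),
    ← ENNReal.ofReal_add (Real.rpow_nonneg ha0 _)
      (mul_nonneg hs0.le (Real.rpow_nonneg hb0 _)),
    ← ENNReal.ofReal_add (mul_nonneg hc.le (Real.rpow_nonneg (le_max_right _ _) _))
      (add_nonneg (Real.rpow_nonneg hb0 _)
      (mul_nonneg hs0.le (mul_nonneg (Real.rpow_nonneg hb0 _) ha0)))]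
  exact this

/-- Summation of the recursive inequality `b k ≤ h k + κ b (k + 1)`. -/
lemma ENNReal.tsum_le_of_le_add_mul_succ {b h : ℤ → ℝ≥0∞} {κ : ℝ≥0∞} (hκ : κ < 1)
    (hrec : ∀ k, b k ≤ h k + κ * b (k + 1))
    (hbdd : ∀ k, ∃ M : ℝ≥0∞, M ≠ ∞ ∧ ∀ j : ℕ, b (k + j) ≤ M) :
    ∑' k, b k ≤ (1 - κ)⁻¹ * ∑' k, h k := by
  have hfin : ∀ k (N : ℕ),
      b k ≤ ∑ j ∈ Finset.range N, κ ^ j * h (k + j) + κ ^ N * b (k + N) := by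
    intro k N
    induction N with
    | zero => simp
    | succ N ih =>
      refine ih.trans ?_
      rw [Finset.sum_range_succ, add_assoc]
      gcongr
      calc κ ^ N * b (k + N) ≤ κ ^ N * (h (k + N) + κ * b (k + N + 1)) := by gcongr; exact hrec _
        _ = _ := by push_cast; rw [← add_assoc]; ring
  have hpt : ∀ k, b k ≤ ∑' j : ℕ, κ ^ j * h (k + j) := by
    intro k
    obtain ⟨M, hM, hb⟩ := hbdd k
    have hlim : Tendsto (fun N : ℕ => (∑' j : ℕ, κ ^ j * h (k + j)) + κ ^ N * M) atTop
        (𝓝 ((∑' j : ℕ, κ ^ j * h (k + j)) + 0 * M)) :=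
      tendsto_const_nhds.add (ENNReal.Tendsto.mul_const
        (ENNReal.tendsto_pow_atTop_nhds_zero_of_lt_one hκ) (Or.inr hM))
    rw [zero_mul, add_zero] at hlim
    refine ge_of_tendsto' hlim fun N => (hfin k N).trans ?_
    gcongr
    · exact ENNReal.sum_le_tsum _
    · exact hb N
  calc ∑' k, b k ≤ ∑' k, ∑' j : ℕ, κ ^ j * h (k + j) := ENNReal.tsum_le_tsum hpt
    _ = ∑' j : ℕ, ∑' k, κ ^ j * h (k + j) := ENNReal.tsum_comm
    _ = ∑' j : ℕ, κ ^ j * ∑' k, h k := by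
      congr 1; ext j
      rw [ENNReal.tsum_mul_left]
      congr 1
      exact (Equiv.addRight (j : ℤ)).tsum_eq h
    _ = _ := by rw [ENNReal.tsum_mul_right, ENNReal.tsum_geometric]

/-- Hölder's inequality for sums in `ℝ≥0∞`. -/
lemma ENNReal.tsum_mul_rpow_le {ι : Type*} (f g : ι → ℝ≥0∞) {s : ℝ} (hs : 1 < s) :
    (∑' i, f i ^ ((s - 1) / s) * g i ^ (1 / s)) ^ s ≤ (∑' i, f i) ^ (s - 1) * ∑' i, g i := by
  have hs0 : 0 < s := by linarith
  have hs1 : s - 1 ≠ 0 := by linarith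
  let _ : MeasurableSpace ι := ⊤
  have : MeasurableSingletonClass ι := ⟨fun _ => trivial⟩
  have hpq : (s / (s - 1)).HolderConjugate s :=
    (Real.HolderConjugate.conjExponent hs).symm
  have := ENNReal.lintegral_mul_le_Lp_mul_Lq Measure.count hpq
    (f := fun i => f i ^ ((s - 1) / s)) (g := fun i => g i ^ (1 / s))
    (Measurable.of_discrete).aemeasurable (Measurable.of_discrete).aemeasurable
  simp only [lintegral_count, Pi.mul_apply, ← ENNReal.rpow_mul] at this
  rw [show (s - 1) / s * (s / (s - 1)) = 1 by field_simp, show 1 / s * s = 1 by field_simp] at this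
  simp only [ENNReal.rpow_one] at this
  calc _ ≤ ((∑' i, f i) ^ (1 / (s / (s - 1))) * (∑' i, g i) ^ (1 / s)) ^ s := by
        gcongr
    _ = _ := by
      rw [ENNReal.mul_rpow_of_nonneg _ _ hs0.le, ← ENNReal.rpow_mul, ← ENNReal.rpow_mul,
        show 1 / (s / (s - 1)) * s = s - 1 by field_simp, show 1 / s * s = 1 by field_simp,
        ENNReal.rpow_one]

/-- A nested sequence of countable partitions of a measure space, indexed by the scale `k : ℤ`,
in which all cells of the same scale have the same measure. The cell of scale `k` containing `x`
is labelled by `idx k x`. -/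
structure DyadicSystem {X : Type*} [MeasurableSpace X] (μ : Measure X) (I : Type*)
    [MeasurableSpace I] where
  idx : ℤ → X → I
  measurable_idx : ∀ k, Measurable (idx k)
  parent : ℤ → I → I
  idx_succ : ∀ k x, idx (k + 1) x = parent k (idx k x)
  vol : ℤ → ℝ≥0∞
  measure_cell : ∀ k m, μ (idx k ⁻¹' {m}) = vol k
  vol_ne_zero : ∀ k, vol k ≠ 0
  vol_ne_top : ∀ k, vol k ≠ ∞

namespace DyadicSystem

variable {X : Type*} [MeasurableSpace X] {μ : Measure X} {I : Type*} [MeasurableSpace I]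

/-- The average of `f` over the cell of scale `k` with label `m`. -/
def avg (D : DyadicSystem μ I) (f : X → ℝ≥0∞) (k : ℤ) (m : I) : ℝ≥0∞ :=
  (D.vol k)⁻¹ * ∫⁻ y in D.idx k ⁻¹' {m}, f y ∂μ

/-- The excess of the average over a cell above `θ` times the average over its parent cell. -/
def excess (D : DyadicSystem μ I) (θ : ℝ) (f : X → ℝ≥0∞) (k : ℤ) (m : I) : ℝ≥0∞ :=
  D.avg f k m - ENNReal.ofReal θ * D.avg f (k + 1) (D.parent k m)

lemma excess_idx (D : DyadicSystem μ I) (θ : ℝ) (f : X → ℝ≥0∞) (k : ℤ) (x : X) :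
    D.excess θ f k (D.idx k x)
      = D.avg f k (D.idx k x) - ENNReal.ofReal θ * D.avg f (k + 1) (D.idx (k + 1) x) := by
  rw [excess, D.idx_succ]

lemma measurableSet_cell [MeasurableSingletonClass I] (D : DyadicSystem μ I) (k : ℤ) (m : I) :
    MeasurableSet (D.idx k ⁻¹' {m}) :=
  D.measurable_idx k (measurableSet_singleton m)

lemma avg_rpow_le (D : DyadicSystem μ I) {f : X → ℝ≥0∞} (hf : Measurable f) {s : ℝ} (hs : 1 < s)
    (k : ℤ) (m : I) :
    D.avg f k m ^ s ≤ D.avg (fun x => f x ^ s) k m := by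
  have hs0 : 0 < s := by linarith
  have hs1 : s - 1 ≠ 0 := by linarith
  have hpq : (s / (s - 1)).HolderConjugate s :=
    (Real.HolderConjugate.conjExponent hs).symm
  have h := ENNReal.lintegral_mul_le_Lp_mul_Lq (μ.restrict (D.idx k ⁻¹' {m})) hpq
    (f := fun _ => 1) (g := f) aemeasurable_const hf.aemeasurable
  simp only [Pi.mul_apply, one_mul, ENNReal.one_rpow, lintegral_const, Measure.restrict_apply,
    MeasurableSet.univ, univ_inter, D.measure_cell] at h
  have h2 := ENNReal.rpow_le_rpow h hs0.le
  rw [ENNReal.mul_rpow_of_nonneg _ _ hs0.le, ← ENNReal.rpow_mul, ← ENNReal.rpow_mul,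
    show 1 / (s / (s - 1)) * s = s - 1 by field_simp, show 1 / s * s = 1 by field_simp,
    ENNReal.rpow_one] at h2
  rw [avg, avg, ENNReal.mul_rpow_of_nonneg _ _ hs0.le]
  calc (D.vol k)⁻¹ ^ s * (∫⁻ y in D.idx k ⁻¹' {m}, f y ∂μ) ^ s
      ≤ (D.vol k)⁻¹ ^ s * (D.vol k ^ (s - 1) * ∫⁻ y in D.idx k ⁻¹' {m}, f y ^ s ∂μ) := by gcongr
    _ = _ := by
      rw [← mul_assoc]
      congr 1
      rw [ENNReal.inv_rpow, ← ENNReal.rpow_neg,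
        ← ENNReal.rpow_add _ _ (D.vol_ne_zero k) (D.vol_ne_top k),
        show -s + (s - 1) = -1 by ring, ENNReal.rpow_neg_one]

lemma avg_le (D : DyadicSystem μ I) {f : X → ℝ≥0∞} (hf : Measurable f) {s : ℝ}
    (hs : 1 < s) (k : ℤ) (m : I) :
    D.avg f k m ≤ (D.vol k)⁻¹ ^ (1 / s) * (∫⁻ x, f x ^ s ∂μ) ^ (1 / s) := by
  have hs0 : 0 < s := by linarith
  rw [← ENNReal.mul_rpow_of_nonneg _ _ (by positivity), one_div, ENNReal.le_rpow_inv_iff hs0]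
  refine (D.avg_rpow_le hf hs k m).trans ?_
  rw [avg]
  gcongr
  exact Measure.restrict_le_self

variable [Countable I] [MeasurableSingletonClass I]

lemma lintegral_comp_idx (D : DyadicSystem μ I) (ν : Measure X) (k : ℤ) (h : I → ℝ≥0∞) :
    ∫⁻ x, h (D.idx k x) ∂ν = ∑' m, h m * ν (D.idx k ⁻¹' {m}) := by
  rw [← lintegral_map (Measurable.of_discrete) (D.measurable_idx k), lintegral_countable']
  congr 1; ext m
  rw [Measure.map_apply (D.measurable_idx k) (measurableSet_singleton m)]

lemma measurable_comp_idx (D : DyadicSystem μ I) (k : ℤ) (h : I → ℝ≥0∞) :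
    Measurable fun x => h (D.idx k x) :=
  (Measurable.of_discrete (f := h)).comp (D.measurable_idx k)

lemma lintegral_mul_avg (D : DyadicSystem μ I) {f : X → ℝ≥0∞} (hf : Measurable f) (k : ℤ)
    (h : I → ℝ≥0∞) :
    ∫⁻ x, h (D.idx k x) * D.avg f k (D.idx k x) ∂μ = ∫⁻ x, h (D.idx k x) * f x ∂μ := by
  have h1 : ∫⁻ x, h (D.idx k x) * f x ∂μ = ∫⁻ x, h (D.idx k x) ∂(μ.withDensity f) := by
    rw [lintegral_withDensity_eq_lintegral_mul _ hf (D.measurable_comp_idx k h)]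
    simp only [Pi.mul_apply, mul_comm]
  rw [h1, D.lintegral_comp_idx _ k h, D.lintegral_comp_idx μ k (fun m => h m * D.avg f k m)]
  congr 1; ext m
  rw [withDensity_apply _ (D.measurableSet_cell k m), D.measure_cell, avg, mul_assoc, mul_right_comm,
    ENNReal.inv_mul_cancel (D.vol_ne_zero k) (D.vol_ne_top k), one_mul]

lemma lintegral_avg_rpow_le (D : DyadicSystem μ I) {f : X → ℝ≥0∞} (hf : Measurable f) {s : ℝ}
    (hs : 1 < s) (k : ℤ) :
    ∫⁻ x, D.avg f k (D.idx k x) ^ s ∂μ ≤ ∫⁻ x, f x ^ s ∂μ := by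
  have h := D.lintegral_mul_avg (hf.pow_const s) k (fun _ => 1)
  simp only [one_mul] at h
  rw [← h]
  exact lintegral_mono fun x => D.avg_rpow_le hf hs k _

/-- One step of the telescoping estimate for the `s`-th powers of the cell averages. -/
lemma lintegral_excess_add_le (D : DyadicSystem μ I) {f : X → ℝ≥0∞} (hf : Measurable f)
    {s θ c : ℝ} (hs : 1 < s)
    (hc : ∀ a b : ℝ≥0∞, ENNReal.ofReal c * (a - ENNReal.ofReal θ * b) ^ s
        + (b ^ s + ENNReal.ofReal s * (b ^ (s - 1) * a)) ≤ a ^ s + ENNReal.ofReal s * b ^ s)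
    (hfin : ∫⁻ x, f x ^ s ∂μ ≠ ∞) (k : ℤ) :
    ENNReal.ofReal c * ∫⁻ x, D.excess θ f k (D.idx k x) ^ s ∂μ
        + ∫⁻ x, D.avg f (k + 1) (D.idx (k + 1) x) ^ s ∂μ
      ≤ ∫⁻ x, D.avg f k (D.idx k x) ^ s ∂μ := by
  set B := ∫⁻ x, D.avg f (k + 1) (D.idx (k + 1) x) ^ s ∂μ with hB
  have hBfin : B ≠ ∞ := ne_top_of_le_ne_top hfin (D.lintegral_avg_rpow_le hf hs (k + 1))
  have hpow : ∀ b : ℝ≥0∞, b ^ (s - 1) * b = b ^ s := by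
    intro b
    nth_rw 2 [← ENNReal.rpow_one b]
    rw [← ENNReal.rpow_add_of_nonneg _ _ (by linarith) zero_le_one, sub_add_cancel]
  have hcross : ∫⁻ x, D.avg f (k + 1) (D.idx (k + 1) x) ^ (s - 1) * D.avg f k (D.idx k x) ∂μ
      = B := by
    have h1 := D.lintegral_mul_avg hf (k + 1) (fun m => D.avg f (k + 1) m ^ (s - 1))
    have h2 := D.lintegral_mul_avg hf k (fun m => D.avg f (k + 1) (D.parent k m) ^ (s - 1))
    simp only [← D.idx_succ] at h2
    rw [h2, ← h1]
    simp only [hpow, hB]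
  have hm := fun j (p : ℝ) => (D.measurable_comp_idx j (D.avg f j)).pow_const p
  have hsplit : ∫⁻ x, (ENNReal.ofReal c * D.excess θ f k (D.idx k x) ^ s
      + (D.avg f (k + 1) (D.idx (k + 1) x) ^ s + ENNReal.ofReal s *
        (D.avg f (k + 1) (D.idx (k + 1) x) ^ (s - 1) * D.avg f k (D.idx k x)))) ∂μ
      ≤ ∫⁻ x, (D.avg f k (D.idx k x) ^ s
        + ENNReal.ofReal s * D.avg f (k + 1) (D.idx (k + 1) x) ^ s) ∂μ := by
    refine lintegral_mono fun x => ?_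
    rw [excess_idx]
    exact hc _ _
  rw [lintegral_add_left (((D.measurable_comp_idx k (D.excess θ f k)).pow_const s).const_mul _),
    lintegral_const_mul _ ((D.measurable_comp_idx k (D.excess θ f k)).pow_const s),
    lintegral_add_left (hm _ _),
    lintegral_const_mul' _ _ ENNReal.ofReal_ne_top,
    hcross, lintegral_add_left (hm _ _), lintegral_const_mul' _ _ ENNReal.ofReal_ne_top, ← hB,
    ← add_assoc] at hsplit
  exact (ENNReal.add_le_add_iff_right (ENNReal.mul_ne_top ENNReal.ofReal_ne_top hBfin)).1 hsplit

/-- The excesses of the averages of an `L^s` function are `s`-summable over all scales. -/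
lemma tsum_lintegral_excess_le (D : DyadicSystem μ I) {f : X → ℝ≥0∞} (hf : Measurable f)
    {s θ c : ℝ} (hs : 1 < s)
    (hc : ∀ a b : ℝ≥0∞, ENNReal.ofReal c * (a - ENNReal.ofReal θ * b) ^ s
        + (b ^ s + ENNReal.ofReal s * (b ^ (s - 1) * a)) ≤ a ^ s + ENNReal.ofReal s * b ^ s)
    (hfin : ∫⁻ x, f x ^ s ∂μ ≠ ∞) :
    ENNReal.ofReal c * ∑' k, ∫⁻ x, D.excess θ f k (D.idx k x) ^ s ∂μ ≤ ∫⁻ x, f x ^ s ∂μ := by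
  have hstep : ∀ (k : ℤ) (N : ℕ),
      ∑ j ∈ Finset.range N, ENNReal.ofReal c *
          ∫⁻ x, D.excess θ f (k + j) (D.idx (k + j) x) ^ s ∂μ
        + ∫⁻ x, D.avg f (k + N) (D.idx (k + N) x) ^ s ∂μ ≤ ∫⁻ x, f x ^ s ∂μ := by
    intro k N
    induction N with
    | zero => simpa using D.lintegral_avg_rpow_le hf hs k
    | succ N ih =>
      refine le_trans ?_ ih
      rw [Finset.sum_range_succ, add_assoc]
      gcongr
      have := D.lintegral_excess_add_le hf hs hc hfin (k + N)
      push_cast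
      rwa [← add_assoc k]
  rw [← ENNReal.tsum_mul_left, ENNReal.tsum_eq_iSup_sum]
  refine iSup_le fun S => ?_
  obtain ⟨a, ha⟩ := S.bddBelow
  obtain ⟨b, hb⟩ := S.bddAbove
  have hsub : S ⊆ (Finset.range (b - a + 1).toNat).image (fun j : ℕ => a + (j : ℤ)) := by
    intro z hz
    have h1 := ha hz
    have h2 := hb hz
    simp only [Finset.mem_image, Finset.mem_range]
    exact ⟨(z - a).toNat, by omega, by omega⟩
  refine (Finset.sum_le_sum_of_subset hsub).trans ?_
  rw [Finset.sum_image (fun x _ y _ h => by simpa using h)]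
  exact le_self_add.trans (hstep a _)

end DyadicSystem

lemma four_rpow_add (x y : ℝ) : (4 : ℝ≥0∞) ^ (x + y) = 4 ^ x * 4 ^ y :=
  ENNReal.rpow_add _ _ (by norm_num) (by norm_num)

lemma four_rpow_ne_zero (x : ℝ) : (4 : ℝ≥0∞) ^ x ≠ 0 := by
  simp [ENNReal.rpow_eq_zero_iff]

lemma four_rpow_ne_top (x : ℝ) : (4 : ℝ≥0∞) ^ x ≠ ∞ := by
  simp [ENNReal.rpow_eq_top_iff]

lemma four_rpow_le {x y : ℝ} (h : x ≤ y) : (4 : ℝ≥0∞) ^ x ≤ 4 ^ y :=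
  ENNReal.rpow_le_rpow_of_exponent_le (by norm_num) h

namespace DyadicSystem

variable {X : Type*} [MeasurableSpace X] {μ : Measure X} {I : Type*} [MeasurableSpace I]

/-- The dyadic Riesz potential of order `α`. -/
def potential (D : DyadicSystem μ I) (α : ℝ) (f : X → ℝ≥0∞) (x : X) : ℝ≥0∞ :=
  ∑' k : ℤ, 4 ^ ((k : ℝ) * α) * D.avg f k (D.idx k x)

/-- The dyadic Wolff potential of `ν`. -/
def wolffPotential (D : DyadicSystem μ I) (d α s : ℝ) (ν : Measure X) (x : X) : ℝ≥0∞ :=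
  ∑' k : ℤ, 4 ^ (-(k : ℝ) * ((d - α * s) / (s - 1)))
    * ν (D.idx k ⁻¹' {D.idx k x}) ^ (1 / (s - 1))

/-- The dyadic Riesz potential is controlled by the excesses of the averages, since slowly
varying averages contribute a geometrically decaying amount. -/
lemma potential_le (D : DyadicSystem μ I) {d α s : ℝ} (hs : 1 < s) (hα : 0 < α)
    (hαs : α * s < d) (hvol : ∀ k, D.vol k = 4 ^ ((k : ℝ) * d)) {f : X → ℝ≥0∞}
    (hf : Measurable f) (hfin : ∫⁻ x, f x ^ s ∂μ ≠ ∞) (x : X) :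
    D.potential α f x ≤ (1 - (4 : ℝ≥0∞) ^ (-(α / 2)))⁻¹ *
      ∑' k : ℤ, 4 ^ ((k : ℝ) * α) * D.excess (4 ^ (α / 2)) f k (D.idx k x) := by
  have hs0 : 0 < s := by linarith
  have hθ : ENNReal.ofReal ((4 : ℝ) ^ (α / 2)) = (4 : ℝ≥0∞) ^ (α / 2) := by
    rw [← ENNReal.ofReal_rpow_of_pos (by norm_num)]; norm_num
  refine ENNReal.tsum_le_of_le_add_mul_succ ?_ (fun k => ?_) (fun k => ?_)
  · exact ENNReal.rpow_lt_one_of_one_lt_of_neg (by norm_num) (by linarith)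
  · rw [excess_idx, hθ]
    calc (4 : ℝ≥0∞) ^ ((k : ℝ) * α) * D.avg f k (D.idx k x)
        ≤ 4 ^ ((k : ℝ) * α) * (D.avg f k (D.idx k x)
            - 4 ^ (α / 2) * D.avg f (k + 1) (D.idx (k + 1) x)
          + 4 ^ (α / 2) * D.avg f (k + 1) (D.idx (k + 1) x)) := by
          gcongr; exact le_tsub_add
      _ = _ := by
          rw [mul_add, ← mul_assoc _ ((4 : ℝ≥0∞) ^ (α / 2)), ← four_rpow_add,
            ← mul_assoc ((4 : ℝ≥0∞) ^ (-(α / 2))), ← four_rpow_add]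
          congr 3
          push_cast; ring
  · refine ⟨4 ^ (-(k : ℝ) * (d / s - α)) * (∫⁻ x, f x ^ s ∂μ) ^ (1 / s),
      ENNReal.mul_ne_top (four_rpow_ne_top _) (ENNReal.rpow_ne_top_of_nonneg (by positivity) hfin),
      fun j => ?_⟩
    have hpos : 0 ≤ d / s - α := by
      rw [sub_nonneg, le_div_iff₀ hs0]; exact hαs.le
    calc _ ≤ (4 : ℝ≥0∞) ^ (((k + j : ℤ) : ℝ) * α) *
          ((D.vol (k + j))⁻¹ ^ (1 / s) * (∫⁻ x, f x ^ s ∂μ) ^ (1 / s)) := by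
          gcongr; exact D.avg_le hf hs _ _
      _ = 4 ^ (-((k + j : ℤ) : ℝ) * (d / s - α)) * (∫⁻ x, f x ^ s ∂μ) ^ (1 / s) := by
          rw [hvol, ← ENNReal.rpow_neg, ← ENNReal.rpow_mul, ← mul_assoc, ← four_rpow_add]
          congr 2; ring
      _ ≤ _ := by
          refine mul_le_mul_left (four_rpow_le ?_) _
          have : (0 : ℝ) ≤ j := by positivity
          push_cast
          nlinarith

/-- Hölder's inequality, with the weights dictated by the dyadic Wolff potential of `ν`. -/
lemma potential_rpow_le (D : DyadicSystem μ I) {d α s : ℝ} (hs : 1 < s) (hα : 0 < α)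
    (hαs : α * s < d) (hvol : ∀ k, D.vol k = 4 ^ ((k : ℝ) * d)) {f : X → ℝ≥0∞}
    (hf : Measurable f) (hfin : ∫⁻ x, f x ^ s ∂μ ≠ ∞) (ν : Measure X) (x : X)
    (hν0 : ∀ k, ν (D.idx k ⁻¹' {D.idx k x}) ≠ 0) (hν : ∀ k, ν (D.idx k ⁻¹' {D.idx k x}) ≠ ∞) :
    D.potential α f x ^ s ≤ (1 - (4 : ℝ≥0∞) ^ (-(α / 2)))⁻¹ ^ s *
      (D.wolffPotential d α s ν x ^ (s - 1) *
      ∑' k : ℤ, D.vol k * D.excess (4 ^ (α / 2)) f k (D.idx k x) ^ s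
        / ν (D.idx k ⁻¹' {D.idx k x})) := by
  have hs0 : 0 < s := by linarith
  have hs1 : s - 1 ≠ 0 := by linarith
  refine (ENNReal.rpow_le_rpow (D.potential_le hs hα hαs hvol hf hfin x) hs0.le).trans ?_
  rw [ENNReal.mul_rpow_of_nonneg _ _ hs0.le]
  gcongr
  refine le_trans (le_of_eq ?_) (ENNReal.tsum_mul_rpow_le _ _ hs)
  congr 2; ext k
  set N := ν (D.idx k ⁻¹' {D.idx k x}) with hN
  have hN0 : N ≠ 0 := hν0 k
  have hNt : N ≠ ∞ := hν k
  have hp : (0 : ℝ) ≤ (s - 1) / s := div_nonneg (by linarith) hs0.le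
  have hq : (0 : ℝ) ≤ 1 / s := by positivity
  rw [ENNReal.mul_rpow_of_nonneg _ _ hp, ← ENNReal.rpow_mul, ← ENNReal.rpow_mul,
    ENNReal.div_rpow_of_nonneg _ _ hq, ENNReal.mul_rpow_of_nonneg _ _ hq, hvol,
    ← ENNReal.rpow_mul, ← ENNReal.rpow_mul, mul_one_div_cancel hs0.ne', ENNReal.rpow_one,
    show 1 / (s - 1) * ((s - 1) / s) = 1 / s by field_simp]
  have hNN : N ^ (1 / s) * (N ^ (1 / s))⁻¹ = 1 :=
    ENNReal.mul_inv_cancel (by simp [ENNReal.rpow_eq_zero_iff, hN0, hNt])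
      (ENNReal.rpow_ne_top_of_nonneg hq hNt)
  have hexp : (k : ℝ) * α = -(k : ℝ) * ((d - α * s) / (s - 1)) * ((s - 1) / s)
      + (k : ℝ) * d * (1 / s) := by
    field_simp; ring
  rw [hexp, four_rpow_add]
  set A := (4 : ℝ≥0∞) ^ (-(k : ℝ) * ((d - α * s) / (s - 1)) * ((s - 1) / s))
  set B := (4 : ℝ≥0∞) ^ ((k : ℝ) * d * (1 / s))
  generalize D.excess (4 ^ (α / 2)) f k (D.idx k x) = E
  calc A * B * E = A * B * E * (N ^ (1 / s) * (N ^ (1 / s))⁻¹) := by rw [hNN, mul_one]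
    _ = A * N ^ (1 / s) * (B * E / N ^ (1 / s)) := by rw [div_eq_mul_inv (B * E)]; ring

lemma ae_measure_cell_ne_zero [Countable I] (D : DyadicSystem μ I) (ν : Measure X) :
    ∀ᵐ x ∂ν, ∀ k, ν (D.idx k ⁻¹' {D.idx k x}) ≠ 0 := by
  rw [ae_all_iff]
  intro k
  have : ∀ᵐ x ∂ν, ∀ m : I, ν (D.idx k ⁻¹' {m}) = 0 → D.idx k x ≠ m := by
    rw [ae_all_iff]
    intro m
    by_cases h : ν (D.idx k ⁻¹' {m}) = 0
    · have h' : ∀ᵐ x ∂ν, x ∉ D.idx k ⁻¹' {m} := measure_eq_zero_iff_ae_notMem.1 h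
      filter_upwards [h'] with x hx _ using hx
    · exact ae_of_all _ fun x h2 => absurd h2 h
  filter_upwards [this] with x hx h
  exact hx _ h rfl

variable [Countable I] [MeasurableSingletonClass I]

/-- The dyadic trace inequality: if `u` dominates the dyadic Wolff potential of `u ^ (s - 1) dσ`,
then the dyadic Riesz potential maps `L^s(μ)` to `L^s(σ)`. -/
lemma lintegral_potential_rpow_le (D : DyadicSystem μ I) {d α s c : ℝ} (hs : 1 < s) (hα : 0 < α)
    (hαs : α * s < d) (hvol : ∀ k, D.vol k = 4 ^ ((k : ℝ) * d)) (hc0 : 0 < c)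
    (hc : ∀ a b : ℝ≥0∞, ENNReal.ofReal c * (a - ENNReal.ofReal (4 ^ (α / 2)) * b) ^ s
        + (b ^ s + ENNReal.ofReal s * (b ^ (s - 1) * a)) ≤ a ^ s + ENNReal.ofReal s * b ^ s)
    {f : X → ℝ≥0∞} (hf : Measurable f) (hfin : ∫⁻ x, f x ^ s ∂μ ≠ ∞)
    {σ : Measure X} {u : X → ℝ≥0∞} (hu : Measurable u) (hu0 : ∀ᵐ x ∂σ, 0 < u x ∧ u x < ∞)
    {M : ℝ≥0∞} (hM : M ≠ ∞)
    (hW : ∀ᵐ x ∂σ, D.wolffPotential d α s (σ.withDensity fun y => u y ^ (s - 1)) x ≤ M * u x) :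
    ∫⁻ x, D.potential α f x ^ s ∂σ ≤ (1 - (4 : ℝ≥0∞) ^ (-(α / 2)))⁻¹ ^ s * M ^ (s - 1)
      * ((ENNReal.ofReal c)⁻¹ * ∫⁻ x, f x ^ s ∂μ) := by
  have hs0 : 0 < s := by linarith
  have hs1 : 0 < s - 1 := by linarith
  set θ : ℝ := 4 ^ (α / 2)
  set ν := σ.withDensity fun y => u y ^ (s - 1) with hν
  have hum : Measurable fun y => u y ^ (s - 1) := hu.pow_const _
  have hac : σ ≪ ν := by
    refine withDensity_absolutelyContinuous' hum.aemeasurable ?_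
    filter_upwards [hu0] with x hx
    simp [ENNReal.rpow_eq_zero_iff, hx.1.ne', hx.2.ne]
  set K := (1 - (4 : ℝ≥0∞) ^ (-(α / 2)))⁻¹
  set q : ℤ → I → ℝ≥0∞ := fun k m => D.vol k * D.excess θ f k m ^ s / ν (D.idx k ⁻¹' {m}) with hq
  have hpt : ∀ᵐ x ∂σ, D.potential α f x ^ s ≤
      K ^ s * M ^ (s - 1) * (u x ^ (s - 1) * ∑' k, q k (D.idx k x)) := by
    filter_upwards [hu0, hW, hac.ae_le (D.ae_measure_cell_ne_zero ν)] with x hx hWx hx0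
    have hWfin : D.wolffPotential d α s ν x ≠ ∞ :=
      ne_top_of_le_ne_top (ENNReal.mul_ne_top hM hx.2.ne) hWx
    have hxt : ∀ k, ν (D.idx k ⁻¹' {D.idx k x}) ≠ ∞ := by
      intro k hk
      apply ENNReal.ne_top_of_tsum_ne_top hWfin k
      rw [hk, ENNReal.top_rpow_of_pos (by positivity), ENNReal.mul_top (four_rpow_ne_zero _)]
    refine (D.potential_rpow_le hs hα hαs hvol hf hfin ν x hx0 hxt).trans ?_
    calc K ^ s * (D.wolffPotential d α s ν x ^ (s - 1) * ∑' k, q k (D.idx k x))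
        ≤ K ^ s * ((M * u x) ^ (s - 1) * ∑' k, q k (D.idx k x)) := by gcongr
      _ = _ := by rw [ENNReal.mul_rpow_of_nonneg _ _ hs1.le]; ring
  have hqm : ∀ k, Measurable fun x => q k (D.idx k x) := fun k => D.measurable_comp_idx k (q k)
  have hqint : ∀ k, ∫⁻ x, q k (D.idx k x) ∂ν ≤ ∫⁻ x, D.excess θ f k (D.idx k x) ^ s ∂μ := by
    intro k
    rw [D.lintegral_comp_idx ν k (q k),
      D.lintegral_comp_idx μ k (fun m => D.excess θ f k m ^ s)]
    refine ENNReal.tsum_le_tsum fun m => ?_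
    rw [D.measure_cell, mul_comm (_ ^ s), mul_comm (q k m)]
    exact ENNReal.mul_div_le
  have hqs : Measurable fun x => ∑' k, q k (D.idx k x) := .tsum hqm
  calc ∫⁻ x, D.potential α f x ^ s ∂σ
      ≤ ∫⁻ x, K ^ s * M ^ (s - 1) * (u x ^ (s - 1) * ∑' k, q k (D.idx k x)) ∂σ :=
        lintegral_mono_ae hpt
    _ = K ^ s * M ^ (s - 1) * ∫⁻ x, ∑' k, q k (D.idx k x) ∂ν := by
        have hprod : Measurable fun x => u x ^ (s - 1) * ∑' k, q k (D.idx k x) := hum.mul hqs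
        rw [lintegral_const_mul _ hprod, lintegral_withDensity_eq_lintegral_mul _ hum hqs]
        rfl
    _ = K ^ s * M ^ (s - 1) * ∑' k, ∫⁻ x, q k (D.idx k x) ∂ν := by
        rw [lintegral_tsum fun k => (hqm k).aemeasurable]
    _ ≤ K ^ s * M ^ (s - 1) * ∑' k, ∫⁻ x, D.excess θ f k (D.idx k x) ^ s ∂μ := by
        exact mul_le_mul_right (ENNReal.tsum_le_tsum hqint) _
    _ ≤ _ := by
        gcongr
        have hc' : ENNReal.ofReal c ≠ 0 := by simpa using hc0
        have := D.tsum_lintegral_excess_le hf hs hc hfin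
        rw [← ENNReal.div_eq_inv_mul, ENNReal.le_div_iff_mul_le (Or.inl hc')
          (Or.inl ENNReal.ofReal_ne_top), mul_comm]
        exact this

end DyadicSystem

lemma ofReal_four_rpow (x : ℝ) : ENNReal.ofReal ((4 : ℝ) ^ x) = 4 ^ x := by
  rw [← ENNReal.ofReal_rpow_of_pos (by norm_num)]; norm_num

/-- The grid of half-open cubes of side lengths `4 ^ k`, shifted by a third of the side length
in the coordinate directions `i` with `t i = 1`. -/
def shiftedGrid (n : ℕ) (t : Fin n → Fin 2) :
    DyadicSystem (volume : Measure (En n)) (Fin n → ℤ) where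
  idx k x i := ⌊x i / (4 : ℝ) ^ k - ((t i : ℕ) : ℝ) / 3⌋
  measurable_idx k := by
    refine measurable_pi_lambda _ fun i => Int.measurable_floor.comp ?_
    exact ((measurable_pi_apply i).comp (WithLp.measurable_ofLp 2 _)).div_const _ |>.sub_const _
  parent _ m i := (m i - (t i : ℕ)) / 4
  idx_succ k x := by
    ext i
    have h := Int.floor_div_natCast (x i / (4 : ℝ) ^ k - ((t i : ℕ) : ℝ) / 3 - ((t i : ℕ) : ℤ)) 4
    rw [Int.floor_sub_intCast] at h
    simp only [Nat.cast_ofNat] at h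
    rw [← h]
    congr 1
    rw [zpow_add₀ (by norm_num), zpow_one]
    push_cast
    field_simp
    ring
  vol k := 4 ^ ((k : ℝ) * n)
  measure_cell k m := by
    have h4 : (0 : ℝ) < 4 ^ k := by positivity
    have hset : (fun (x : En n) i => ⌊x i / (4 : ℝ) ^ k - ((t i : ℕ) : ℝ) / 3⌋) ⁻¹' {m}
        = (MeasurableEquiv.toLp 2 (Fin n → ℝ)).symm ⁻¹' (Set.univ.pi fun i =>
          Set.Ico ((m i + ((t i : ℕ) : ℝ) / 3) * 4 ^ k)
            ((m i + 1 + ((t i : ℕ) : ℝ) / 3) * 4 ^ k)) := by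
      ext x
      simp only [mem_preimage, mem_singleton_iff, Set.mem_pi, Set.mem_univ, true_imp_iff,
        Set.mem_Ico, funext_iff, Int.floor_eq_iff]
      refine forall_congr' fun i => and_congr ?_ ?_
      · rw [le_sub_iff_add_le, le_div_iff₀ h4]; rfl
      · rw [sub_lt_iff_lt_add, div_lt_iff₀ h4]; rfl
    rw [hset, (EuclideanSpace.volume_preserving_symm_measurableEquiv_toLp
      (Fin n)).measure_preimage_equiv, Real.volume_pi_Ico]
    have : ∀ i, (m i + 1 + ((t i : ℕ) : ℝ) / 3) * (4 : ℝ) ^ k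
        - (m i + ((t i : ℕ) : ℝ) / 3) * 4 ^ k = (4 : ℝ) ^ (k : ℝ) := by
      intro i; rw [Real.rpow_intCast]; ring
    simp only [this, ofReal_four_rpow, Finset.prod_const, Finset.card_univ, Fintype.card_fin]
    rw [← ENNReal.rpow_natCast, ← ENNReal.rpow_mul]
  vol_ne_zero _ := four_rpow_ne_zero _
  vol_ne_top _ := four_rpow_ne_top _

lemma dist_le_of_shiftedGrid_idx_eq {n : ℕ} {t : Fin n → Fin 2} {k : ℤ} {x y : En n}
    (h : (shiftedGrid n t).idx k y = (shiftedGrid n t).idx k x) : dist y x ≤ n * (4 : ℝ) ^ k := by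
  have h4 : (0 : ℝ) < 4 ^ k := by positivity
  have hi : ∀ i, dist (y i) (x i) ^ 2 ≤ ((4 : ℝ) ^ k) ^ 2 := by
    intro i
    have h1 := Int.abs_sub_lt_one_of_floor_eq_floor (congrFun h i)
    rw [sub_sub_sub_cancel_right, ← sub_div, abs_div, abs_of_pos h4, div_lt_one h4] at h1
    exact pow_le_pow_left₀ dist_nonneg h1.le 2
  rw [EuclideanSpace.dist_eq]
  refine Real.sqrt_le_iff.2 ⟨by positivity, ?_⟩
  calc ∑ i, dist (y i) (x i) ^ 2 ≤ ∑ _i : Fin n, ((4 : ℝ) ^ k) ^ 2 :=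
        Finset.sum_le_sum fun i _ => hi i
    _ = n * ((4 : ℝ) ^ k) ^ 2 := by simp
    _ ≤ (n : ℝ) ^ 2 * ((4 : ℝ) ^ k) ^ 2 := by
        gcongr
        exact_mod_cast Nat.le_self_pow two_ne_zero n
    _ = _ := by ring

/-- Two reals at distance less than `1 / 3` are not separated by both `ℤ` and `ℤ + 1 / 3`. -/
lemma exists_floor_sub_third_eq {a b : ℝ} (h : |a - b| < 1 / 3) :
    ∃ τ : Fin 2, ⌊a - ((τ : ℕ) : ℝ) / 3⌋ = ⌊b - ((τ : ℕ) : ℝ) / 3⌋ := by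
  wlog hab : a ≤ b generalizing a b
  · obtain ⟨τ, hτ⟩ := this (by rwa [abs_sub_comm]) (le_of_not_ge hab)
    exact ⟨τ, hτ.symm⟩
  rw [abs_sub_lt_iff] at h
  rcases (Int.floor_le_floor hab).eq_or_lt with h0 | h0
  · exact ⟨0, by simpa using h0⟩
  · refine ⟨1, ?_⟩
    have h1 : a < ⌊b⌋ := Int.floor_lt.1 h0
    have h2 := Int.floor_le b
    have e1 : ⌊a - ((1 : ℕ) : ℝ) / 3⌋ = ⌊b⌋ - 1 := by
      rw [Int.floor_eq_iff]; push_cast; constructor <;> linarith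
    have e2 : ⌊b - ((1 : ℕ) : ℝ) / 3⌋ = ⌊b⌋ - 1 := by
      rw [Int.floor_eq_iff]; push_cast; constructor <;> linarith
    exact e1.trans e2.symm

/-- The Riesz kernel is dominated by the dyadic kernels of the shifted grids. -/
lemma riesz_kernel_le {n : ℕ} {α : ℝ} (hα : α < n) (x y : En n) :
    ENNReal.ofReal (‖x - y‖ ^ (α - (n : ℝ))) ≤ ENNReal.ofReal (12 ^ ((n : ℝ) - α)) *
      ∑ t : Fin n → Fin 2, ∑' k : ℤ, 4 ^ ((k : ℝ) * (α - n)) *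
        ((shiftedGrid n t).idx k ⁻¹' {(shiftedGrid n t).idx k x}).indicator 1 y := by
  rcases eq_or_ne x y with rfl | hxy
  · rw [sub_self, norm_zero, Real.zero_rpow (by linarith), ENNReal.ofReal_zero]
    exact zero_le
  have hd : 0 < ‖x - y‖ := norm_pos_iff.2 (sub_ne_zero.2 hxy)
  obtain ⟨j, hj1, hj2⟩ := exists_mem_Ico_zpow (K := ℝ) (x := 3 * ‖x - y‖) (y := 4)
    (by positivity) (by norm_num)
  have h4 : (0 : ℝ) < 4 ^ (j + 1) := by positivity
  have hcoord : ∀ i, ∃ τ : Fin 2, ⌊y i / (4 : ℝ) ^ (j + 1) - ((τ : ℕ) : ℝ) / 3⌋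
      = ⌊x i / (4 : ℝ) ^ (j + 1) - ((τ : ℕ) : ℝ) / 3⌋ := by
    intro i
    apply exists_floor_sub_third_eq
    have h1 : |y i - x i| ≤ ‖x - y‖ := by
      rw [abs_sub_comm]
      exact PiLp.norm_apply_le (x - y) i
    rw [← sub_div, abs_div, abs_of_pos h4, div_lt_iff₀ h4]
    linarith
  choose t ht using hcoord
  have hmem : y ∈ (shiftedGrid n t).idx (j + 1) ⁻¹' {(shiftedGrid n t).idx (j + 1) x} :=
    funext ht
  have hdist : ‖x - y‖ ^ (α - (n : ℝ)) ≤
      12 ^ ((n : ℝ) - α) * 4 ^ (((j + 1 : ℤ) : ℝ) * (α - n)) := by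
    have hlow : (4 : ℝ) ^ (((j + 1 : ℤ) : ℝ)) / 12 ≤ ‖x - y‖ := by
      rw [Real.rpow_intCast, zpow_add₀ (by norm_num), zpow_one]; linarith
    calc ‖x - y‖ ^ (α - (n : ℝ)) ≤ ((4 : ℝ) ^ (((j + 1 : ℤ) : ℝ)) / 12) ^ (α - (n : ℝ)) :=
          Real.rpow_le_rpow_of_nonpos (by positivity) hlow (by linarith)
      _ = _ := by
          rw [Real.div_rpow (by positivity) (by norm_num), ← Real.rpow_mul (by norm_num),
            div_eq_mul_inv, ← Real.rpow_neg (by norm_num), neg_sub, mul_comm]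
  refine (ENNReal.ofReal_le_ofReal hdist).trans ?_
  rw [ENNReal.ofReal_mul (by positivity), ofReal_four_rpow]
  gcongr
  refine le_trans (le_of_eq ?_) ((ENNReal.le_tsum (j + 1)).trans (Finset.single_le_sum
    (f := fun t => ∑' k : ℤ, (4 : ℝ≥0∞) ^ ((k : ℝ) * (α - n)) *
      ((shiftedGrid n t).idx k ⁻¹' {(shiftedGrid n t).idx k x}).indicator 1 y)
    (fun _ _ => zero_le) (Finset.mem_univ t)))
  rw [indicator_of_mem hmem, Pi.one_apply, mul_one]

/-- The Riesz potential is dominated by the dyadic Riesz potentials of the shifted grids. -/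
lemma rieszPot_le {n : ℕ} {α : ℝ} (hα : α < n) {f : En n → ℝ≥0∞} (hf : Measurable f)
    (x : En n) :
    rieszPot n α f x ≤ ENNReal.ofReal (((n : ℝ) - α)⁻¹) * ENNReal.ofReal (12 ^ ((n : ℝ) - α)) *
      ∑ t : Fin n → Fin 2, (shiftedGrid n t).potential α f x := by
  rw [rieszPot, mul_assoc]
  gcongr
  set Q := fun (t : Fin n → Fin 2) (k : ℤ) =>
    (shiftedGrid n t).idx k ⁻¹' {(shiftedGrid n t).idx k x}
  have hQ : ∀ t k, MeasurableSet (Q t k) := fun t k => (shiftedGrid n t).measurableSet_cell k _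
  have hterm : ∀ t (k : ℤ), Measurable fun y => (4 : ℝ≥0∞) ^ ((k : ℝ) * (α - n)) * (Q t k).indicator f y :=
    fun t k => (hf.indicator (hQ t k)).const_mul _
  calc ∫⁻ y, f y * ENNReal.ofReal (‖x - y‖ ^ (α - (n : ℝ)))
      ≤ ∫⁻ y, ENNReal.ofReal (12 ^ ((n : ℝ) - α)) *
          ∑ t, ∑' k : ℤ, 4 ^ ((k : ℝ) * (α - n)) * (Q t k).indicator f y := by
        refine lintegral_mono fun y => ?_
        refine (mul_le_mul_right (riesz_kernel_le hα x y) _).trans (le_of_eq ?_)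
        rw [mul_left_comm, Finset.mul_sum]
        congr 2; ext t
        rw [← ENNReal.tsum_mul_left]
        congr 1; ext k
        rw [mul_left_comm]
        congr 1
        by_cases hy : y ∈ Q t k
        · rw [indicator_of_mem hy, indicator_of_mem hy, Pi.one_apply, mul_one]
        · rw [indicator_of_notMem hy, indicator_of_notMem hy, mul_zero]
    _ = ENNReal.ofReal (12 ^ ((n : ℝ) - α)) *
          ∑ t, ∑' k : ℤ, 4 ^ ((k : ℝ) * (α - n)) * ∫⁻ y in Q t k, f y := by
        rw [lintegral_const_mul' _ _ ENNReal.ofReal_ne_top,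
          lintegral_finsetSum _ fun t _ => .tsum (hterm t)]
        congr 2; ext t
        rw [lintegral_tsum fun k => (hterm t k).aemeasurable]
        congr 1; ext k
        rw [lintegral_const_mul' _ _ (four_rpow_ne_top _), lintegral_indicator (hQ t k)]
    _ = _ := by
        congr 2; ext t
        rw [DyadicSystem.potential]
        congr 1; ext k
        rw [DyadicSystem.avg, ← mul_assoc]
        congr 1
        change _ = (4 : ℝ≥0∞) ^ ((k : ℝ) * α) * (4 ^ ((k : ℝ) * n))⁻¹
        rw [← ENNReal.rpow_neg, ← four_rpow_add]
        congr 1; ring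

/-- The dyadic Wolff potential is dominated by the nonlinear operator `Nop`. -/
lemma wolffPotential_le_Nop {n : ℕ} (hn : 2 ≤ n) {α s : ℝ} (hs : 1 < s) (hαs : α * s < n)
    (σ : Measure (En n)) (u : En n → ℝ≥0∞) (t : Fin n → Fin 2) (x : En n) :
    ENNReal.ofReal (3 / 4 * (4 * n) ^ (-(((n : ℝ) - α * s) / (s - 1)))) *
      (shiftedGrid n t).wolffPotential n α s (σ.withDensity fun y => u y ^ (s - 1)) x
      ≤ Nop n α s σ u x := by
  have hs1 : 0 < s - 1 := by linarith
  have hn0 : (0 : ℝ) < n := by exact_mod_cast (by omega : 0 < n)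
  set β := ((n : ℝ) - α * s) / (s - 1)
  have hβ : 0 ≤ 1 / (s - 1) := by positivity
  set ν := σ.withDensity fun y => u y ^ (s - 1)
  set F : ℝ → ℝ≥0∞ := fun r =>
    (ENNReal.ofReal (r ^ (α * s - (n : ℝ))) * ∫⁻ y in Metric.ball x r, (u y) ^ (s - 1) ∂σ)
        ^ (1 / (s - 1)) * ENNReal.ofReal r⁻¹ with hF
  set J : ℤ → Set ℝ := fun k => Ioc (n * (4 : ℝ) ^ k) (n * (4 : ℝ) ^ (k + 1)) with hJ
  have hmono : Monotone fun k : ℤ => n * (4 : ℝ) ^ k := fun a b hab =>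
    mul_le_mul_of_nonneg_left (zpow_le_zpow_right₀ (by norm_num) hab) hn0.le
  have hdisj : Pairwise (Function.onFun Disjoint J) := hmono.pairwise_disjoint_on_Ioc_succ
  have hsub : (⋃ k, J k) ⊆ Ioi 0 := by
    refine iUnion_subset fun k r hr => ?_
    exact lt_trans (by positivity) hr.1
  have hJk : ∀ k : ℤ, ENNReal.ofReal (3 / 4 * (4 * n) ^ (-β)) * (4 ^ (-(k : ℝ) * β)
      * ν ((shiftedGrid n t).idx k ⁻¹' {(shiftedGrid n t).idx k x}) ^ (1 / (s - 1)))
      ≤ ∫⁻ r in J k, F r := by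
    intro k
    set N := ν ((shiftedGrid n t).idx k ⁻¹' {(shiftedGrid n t).idx k x})
    set m := n * (4 : ℝ) ^ (k + 1) with hm
    have hm0 : 0 < m := by positivity
    have hlow : ∀ r ∈ J k, (ENNReal.ofReal (m ^ (α * s - (n : ℝ))) * N) ^ (1 / (s - 1))
        * ENNReal.ofReal m⁻¹ ≤ F r := by
      intro r hr
      have hr0 : 0 < r := lt_trans (by positivity) hr.1
      have hN : N ≤ ∫⁻ y in Metric.ball x r, (u y) ^ (s - 1) ∂σ := by
        rw [← withDensity_apply _ measurableSet_ball]
        refine measure_mono fun y hy => ?_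
        exact (dist_le_of_shiftedGrid_idx_eq hy).trans_lt hr.1
      simp only [hF]
      gcongr ?_ * ?_
      · refine ENNReal.rpow_le_rpow (mul_le_mul' (ENNReal.ofReal_le_ofReal ?_) hN) hβ
        exact Real.rpow_le_rpow_of_nonpos hr0 hr.2 (by linarith)
      · exact ENNReal.ofReal_le_ofReal (inv_anti₀ hr0 hr.2)
    have hconst := setLIntegral_mono' (μ := volume) (measurableSet_Ioc) hlow
    rw [setLIntegral_const, Real.volume_Ioc] at hconst
    refine le_trans (le_of_eq ?_) hconst
    rw [ENNReal.mul_rpow_of_nonneg _ _ hβ, ENNReal.ofReal_rpow_of_pos (by positivity),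
      ← ofReal_four_rpow, ← Real.rpow_mul hm0.le]
    have e1 : (α * s - (n : ℝ)) * (1 / (s - 1)) = -β := by
      simp only [β]; ring
    have e2 : m ^ (-β) = (4 * n) ^ (-β) * 4 ^ (-(k : ℝ) * β) := by
      rw [hm, zpow_add₀ (by norm_num), zpow_one,
        show (n : ℝ) * (4 ^ k * 4) = 4 * n * 4 ^ k by ring,
        Real.mul_rpow (by positivity) (by positivity), ← Real.rpow_intCast,
        ← Real.rpow_mul (by norm_num)]
      congr 2; ring
    have e3 : m⁻¹ * (m - n * 4 ^ k) = 3 / 4 := by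
      rw [hm, zpow_add₀ (by norm_num), zpow_one]
      field_simp; norm_num
    have hp : 0 ≤ m - n * 4 ^ k := by
      by_contra hneg
      have := mul_neg_of_pos_of_neg (inv_pos.2 hm0) (not_le.1 hneg)
      linarith
    rw [e1, mul_assoc (_ * _) _ (ENNReal.ofReal _), ← ENNReal.ofReal_mul (by positivity), e3,
      mul_right_comm (ENNReal.ofReal (m ^ (-β))), ← mul_assoc,
      ← ENNReal.ofReal_mul (by positivity), ← ENNReal.ofReal_mul (by positivity), e2]
    congr 2; ring
  calc _ = ∑' k : ℤ, ENNReal.ofReal (3 / 4 * (4 * n) ^ (-β)) * (4 ^ (-(k : ℝ) * β)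
        * ν ((shiftedGrid n t).idx k ⁻¹' {(shiftedGrid n t).idx k x}) ^ (1 / (s - 1))) := by
        rw [DyadicSystem.wolffPotential, ENNReal.tsum_mul_left]
    _ ≤ ∑' k : ℤ, ∫⁻ r in J k, F r := ENNReal.tsum_le_tsum hJk
    _ = ∫⁻ r in ⋃ k, J k, F r := (lintegral_iUnion (fun _ => measurableSet_Ioc) hdisj _).symm
    _ ≤ Nop n α s σ u x := lintegral_mono_set hsub

/-- if `u` is a positive (σ-a.e. finite) solution of `u ≥ C₀ 𝒩 u` σ-a.e., then
`σ(E) ≤ C cap_{α,s}(E)` for all compact `E`, with `C = C(n, α, s, C₀)`. -/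
theorem statement0 (n : ℕ) (hn : 2 ≤ n) (α s C₀ : ℝ) (hs : 1 < s) (hα : 0 < α)
    (hαs : α * s < n) (hC₀ : 0 < C₀) :
    ∃ C : ℝ, 0 < C ∧
      ∀ σ : Measure (En n), IsLocallyFiniteMeasure σ →
        ∀ u : En n → ℝ≥0∞, Measurable u →
          (∀ᵐ x ∂σ, 0 < u x ∧ u x < ∞) →
          (∀ᵐ x ∂σ, ENNReal.ofReal C₀ * Nop n α s σ u x ≤ u x) →
          ∀ E : Set (En n), IsCompact E →
            σ E ≤ ENNReal.ofReal C * rieszCap n α s E := by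
  have hs0 : 0 < s := by linarith
  have hs1 : 0 < s - 1 := by linarith
  have hn0 : (0 : ℝ) < n := by exact_mod_cast (by omega : 0 < n)
  have hαn : α < n := by nlinarith
  obtain ⟨c, hc0, hc⟩ := ENNReal.exists_convexity_gain (s := s) (θ := 4 ^ (α / 2)) hs
    (Real.one_lt_rpow (by norm_num) (by linarith))
  set w : ℝ≥0∞ := ENNReal.ofReal (3 / 4 * (4 * n) ^ (-(((n : ℝ) - α * s) / (s - 1))))
  have hw0 : w ≠ 0 := by
    have : 0 < 3 / 4 * (4 * (n : ℝ)) ^ (-(((n : ℝ) - α * s) / (s - 1))) := by positivity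
    simpa [w] using this
  have hwt : w ≠ ∞ := ENNReal.ofReal_ne_top
  set M : ℝ≥0∞ := (ENNReal.ofReal C₀ * w)⁻¹
  have hC0 : ENNReal.ofReal C₀ ≠ 0 := by simpa using hC₀
  have hM : M ≠ ∞ := ENNReal.inv_ne_top.2 (mul_ne_zero hC0 hw0)
  set K : ℝ≥0∞ := (1 - (4 : ℝ≥0∞) ^ (-(α / 2)))⁻¹
  have hK : K ≠ ∞ := by
    refine ENNReal.inv_ne_top.2 (tsub_pos_of_lt ?_).ne'
    exact ENNReal.rpow_lt_one_of_one_lt_of_neg (by norm_num) (by linarith)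
  set A : ℝ≥0∞ := ENNReal.ofReal (((n : ℝ) - α)⁻¹) * ENNReal.ofReal (12 ^ ((n : ℝ) - α))
  have hA : A ≠ ∞ := ENNReal.mul_ne_top ENNReal.ofReal_ne_top ENNReal.ofReal_ne_top
  set T : ℝ≥0∞ := ((Finset.univ : Finset (Fin n → Fin 2)).card : ℝ≥0∞)
  set B : ℝ≥0∞ := K ^ s * M ^ (s - 1) * (ENNReal.ofReal c)⁻¹
  have hB : B ≠ ∞ := ENNReal.mul_ne_top (ENNReal.mul_ne_top
    (ENNReal.rpow_ne_top_of_nonneg hs0.le hK) (ENNReal.rpow_ne_top_of_nonneg hs1.le hM))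
    (ENNReal.inv_ne_top.2 (by simpa using hc0))
  set D : ℝ≥0∞ := A ^ s * T ^ (s - 1) * (T * B)
  have hT : T ≠ ∞ := ENNReal.natCast_ne_top _
  have hD : D ≠ ∞ := ENNReal.mul_ne_top (ENNReal.mul_ne_top
    (ENNReal.rpow_ne_top_of_nonneg hs0.le hA) (ENNReal.rpow_ne_top_of_nonneg hs1.le hT))
    (ENNReal.mul_ne_top hT hB)
  refine ⟨D.toReal + 1, by positivity, fun σ _ u hu hu0 hsup E hE => ?_⟩
  have hDC : D ≤ ENNReal.ofReal (D.toReal + 1) :=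
    (ENNReal.ofReal_toReal hD).symm.le.trans (ENNReal.ofReal_le_ofReal (by linarith))
  have hCpos : ENNReal.ofReal (D.toReal + 1) ≠ 0 := by
    have : 0 < D.toReal + 1 := by positivity
    simpa using this
  rw [mul_comm, ← ENNReal.div_le_iff hCpos ENNReal.ofReal_ne_top]
  refine le_iInf fun f => le_iInf fun hf => le_iInf fun hfE => ?_
  rw [ENNReal.div_le_iff hCpos ENNReal.ofReal_ne_top, mul_comm]
  by_cases hfin : ∫⁻ y, f y ^ s = ∞
  · rw [hfin, ENNReal.mul_top hCpos]; exact le_top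
  refine le_trans ?_ (mul_le_mul_left hDC _)
  have hP : ∀ t : Fin n → Fin 2, Measurable fun x => (shiftedGrid n t).potential α f x ^ s :=
    fun t => (Measurable.tsum fun k =>
      ((shiftedGrid n t).measurable_comp_idx k _).const_mul _).pow_const s
  have htrace : ∀ t : Fin n → Fin 2,
      ∫⁻ x, (shiftedGrid n t).potential α f x ^ s ∂σ ≤ B * ∫⁻ y, f y ^ s := by
    intro t
    rw [show B * ∫⁻ y, f y ^ s = K ^ s * M ^ (s - 1) *
      ((ENNReal.ofReal c)⁻¹ * ∫⁻ y, f y ^ s) by rw [← mul_assoc]]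
    refine (shiftedGrid n t).lintegral_potential_rpow_le hs hα hαs (fun _ => rfl) hc0 hc hf hfin
      hu hu0 hM ?_
    filter_upwards [hsup] with x hx
    rw [← ENNReal.div_eq_inv_mul, ENNReal.le_div_iff_mul_le
      (Or.inl (mul_ne_zero hC0 hw0)) (Or.inl (ENNReal.mul_ne_top ENNReal.ofReal_ne_top hwt)),
      mul_comm, mul_assoc]
    refine le_trans ?_ hx
    gcongr
    exact wolffPotential_le_Nop hn hs hαs σ u t x
  calc σ E = ∫⁻ _ in E, 1 ∂σ := by simp
    _ ≤ ∫⁻ x in E, A ^ s * T ^ (s - 1) * ∑ t, (shiftedGrid n t).potential α f x ^ s ∂σ := by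
        refine setLIntegral_mono' hE.measurableSet fun x hx => ?_
        have h1 := (hfE x hx).trans (rieszPot_le hαn hf x)
        have h2 := ENNReal.rpow_le_rpow h1 hs0.le
        rw [ENNReal.one_rpow, ENNReal.mul_rpow_of_nonneg _ _ hs0.le] at h2
        refine h2.trans ?_
        rw [mul_assoc]
        gcongr
        exact ENNReal.rpow_sum_le_const_mul_sum_rpow _ _ hs.le
    _ ≤ ∫⁻ x, A ^ s * T ^ (s - 1) * ∑ t, (shiftedGrid n t).potential α f x ^ s ∂σ :=
        setLIntegral_le_lintegral _ _
    _ = A ^ s * T ^ (s - 1) * ∑ t, ∫⁻ x, (shiftedGrid n t).potential α f x ^ s ∂σ := by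
        rw [lintegral_const_mul _ (Finset.measurable_fun_sum _ fun t _ => hP t),
          lintegral_finsetSum _ fun t _ => hP t]
    _ ≤ A ^ s * T ^ (s - 1) * ∑ _t : Fin n → Fin 2, B * ∫⁻ y, f y ^ s := by
        gcongr with t
        exact htrace t
    _ = D * ∫⁻ y, f y ^ s := by
        rw [Finset.sum_const, nsmul_eq_mul]
        simp only [D, T]
        ring
end
end

section
/- Suppose there exists a Borel measurable function u : ℝⁿ → [0,∞] with 0 < u(x) < ∞ for σ-almost every x and u(x) ≥ C₀·𝒩u(x) for σ-almost every x, where C₀ > 0. Then σ is a discrete Carleson measure: there exists a constant C > 0, depending only on n, α, s and C₀, such that for every dyadic cube P ∈ 𝒟, every t ∈ ℝⁿ and every compact set E ⊂ ℝⁿ one has Σ_{Q ⊆ P, Q ∈ 𝒟} c_Q · σ((Q+t) ∩ E)^{s'} ≤ C·σ((P+t) ∩ E), and moreover Σ_{Q ∈ 𝒟} c_Q · σ((Q+t) ∩ E)^{s'} ≤ C·σ(E), where s' = s/(s−1). -/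
open MeasureTheory Metric Set Filter
open scoped ENNReal NNReal Topology

noncomputable section

/-- The dyadic cube `2^k (λ + [0,1)^n)` in `ℝⁿ`. -/
def dyadicCube (n : ℕ) (k : ℤ) (lam : Fin n → ℤ) : Set (En n) :=
  {x | ∀ i, (2:ℝ)^k * (lam i : ℝ) ≤ x i ∧ x i < (2:ℝ)^k * ((lam i : ℝ) + 1)}

/-- The coefficient `c_Q = ℓ(Q)^{(αs-n)/(s-1)}` for a dyadic cube of sidelength `2^k`. -/
noncomputable def cQ (n : ℕ) (α s : ℝ) (k : ℤ) : ℝ≥0∞ :=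
  ENNReal.ofReal (((2:ℝ)^k) ^ ((α * s - (n:ℝ))/(s-1)))

theorem dist_lt_of_mem_dyadicCube {n : ℕ} {k : ℤ} {lam : Fin n → ℤ} {x y : En n}
    (hx : x ∈ dyadicCube n k lam) (hy : y ∈ dyadicCube n k lam) :
    dist x y < ((n : ℝ) + 1) * 2 ^ k := by
  have h2 : (0 : ℝ) < 2 ^ k := by positivity
  rw [EuclideanSpace.dist_eq, Real.sqrt_lt' (by positivity)]
  calc ∑ i, dist (x i) (y i) ^ 2 ≤ ∑ _i : Fin n, ((2 : ℝ) ^ k) ^ 2 := by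
        refine Finset.sum_le_sum fun i _ => ?_
        have hx' := hx i
        have hy' := hy i
        rw [Real.dist_eq, sq_abs]
        apply sq_le_sq'
        · nlinarith
        · nlinarith
    _ = n * ((2 : ℝ) ^ k) ^ 2 := by simp
    _ < (((n : ℝ) + 1) * 2 ^ k) ^ 2 := by
        rw [mul_pow]
        have : (0 : ℝ) ≤ n := by positivity
        have : (n : ℝ) < ((n : ℝ) + 1) ^ 2 := by nlinarith
        gcongr

theorem eq_of_mem_dyadicCube {n : ℕ} {k : ℤ} {lam mu : Fin n → ℤ} {x : En n}
    (hx : x ∈ dyadicCube n k lam) (hy : x ∈ dyadicCube n k mu) : lam = mu := by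
  have h2 : (0 : ℝ) < 2 ^ k := by positivity
  funext i
  have h1 := (mul_lt_mul_iff_right₀ h2).1 ((hx i).1.trans_lt (hy i).2)
  have h3 := (mul_lt_mul_iff_right₀ h2).1 ((hy i).1.trans_lt (hx i).2)
  norm_cast at h1 h3
  omega

theorem measurableSet_dyadicCube (n : ℕ) (k : ℤ) (lam : Fin n → ℤ) :
    MeasurableSet (dyadicCube n k lam) := by
  unfold dyadicCube
  simp only [ofPred_forall]
  refine MeasurableSet.iInter fun i => ?_
  have h : Measurable fun x : En n => x i := by fun_prop
  exact (measurableSet_le measurable_const h).inter (measurableSet_lt h measurable_const)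

/-- The dyadic sum obtained by splitting the integral defining `𝒩 f` into the annuli
`D 2^k < r ≤ D 2^(k+1)` with `D = n + 1`. -/
theorem tsum_cQ_mul_le_Nop (n : ℕ) {α s : ℝ} (hs : 1 < s) (hαs : α * s < n)
    (σ : Measure (En n)) (f : En n → ℝ≥0∞) (x : En n) :
    ENNReal.ofReal ((1 / 2) * (2 * ((n : ℝ) + 1)) ^ ((α * s - n) / (s - 1))) *
      ∑' k : ℤ, cQ n α s k *
        (∫⁻ y in ball x (((n : ℝ) + 1) * 2 ^ k), f y ^ (s - 1) ∂σ) ^ (1 / (s - 1))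
      ≤ Nop n α s σ f x := by
  have hs' : 0 < s - 1 := by linarith
  have hq : 0 ≤ 1 / (s - 1) := by positivity
  set D : ℝ := (n : ℝ) + 1
  have hD0 : 0 < D := by positivity
  have hmono : Monotone fun k : ℤ => D * (2 : ℝ) ^ k := fun a b hab =>
    mul_le_mul_of_nonneg_left (zpow_le_zpow_right₀ one_le_two hab) hD0.le
  have hdisj : Pairwise (Function.onFun Disjoint
      fun k : ℤ => Ioc (D * (2 : ℝ) ^ k) (D * 2 ^ (k + 1))) := by
    simpa using hmono.pairwise_disjoint_on_Ioc_succ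
  have hsub : (⋃ k : ℤ, Ioc (D * (2 : ℝ) ^ k) (D * 2 ^ (k + 1))) ⊆ Ioi 0 := by
    refine iUnion_subset fun k r hr => ?_
    exact lt_trans (by positivity) hr.1
  unfold Nop
  refine le_trans ?_ (lintegral_mono_set hsub)
  rw [lintegral_iUnion (fun k => measurableSet_Ioc) hdisj, ← ENNReal.tsum_mul_left]
  refine ENNReal.tsum_le_tsum fun k => ?_
  have h2 : (0 : ℝ) < 2 ^ k := by positivity
  have h3 : (2 : ℝ) ^ (k + 1) = 2 * 2 ^ k := by rw [zpow_add_one₀ two_ne_zero]; ring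
  set J := ∫⁻ y in ball x (D * 2 ^ k), f y ^ (s - 1) ∂σ
  calc ENNReal.ofReal ((1 / 2) * (2 * D) ^ ((α * s - n) / (s - 1))) *
        (cQ n α s k * J ^ (1 / (s - 1)))
      = ∫⁻ _ in Ioc (D * (2 : ℝ) ^ k) (D * 2 ^ (k + 1)),
          (ENNReal.ofReal ((D * 2 ^ (k + 1)) ^ (α * s - (n : ℝ))) * J) ^ (1 / (s - 1))
            * ENNReal.ofReal (D * 2 ^ (k + 1))⁻¹ := by
        rw [setLIntegral_const, Real.volume_Ioc, ENNReal.mul_rpow_of_nonneg _ _ hq,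
          ENNReal.ofReal_rpow_of_pos (by positivity), ← Real.rpow_mul (by positivity), cQ,
          mul_assoc (_ * _) (ENNReal.ofReal _) (ENNReal.ofReal _),
          ← ENNReal.ofReal_mul (by positivity), mul_right_comm,
          ← ENNReal.ofReal_mul (by positivity), ← mul_assoc,
          ← ENNReal.ofReal_mul (by positivity)]
        congr 2
        rw [h3, show (α * s - n) * (1 / (s - 1)) = (α * s - n) / (s - 1) by ring,
          show D * (2 * 2 ^ k) = (2 * D) * 2 ^ k by ring,
          Real.mul_rpow (by positivity) h2.le]
        field_simp
        ring
    _ ≤ _ := by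
        refine setLIntegral_mono' measurableSet_Ioc fun r hr => ?_
        have hr0 : 0 < r := lt_trans (by positivity) hr.1
        have e1 : (D * 2 ^ (k + 1)) ^ (α * s - (n : ℝ)) ≤ r ^ (α * s - (n : ℝ)) :=
          Real.rpow_le_rpow_of_nonpos hr0 hr.2 (by linarith)
        have e2 : J ≤ ∫⁻ y in ball x r, f y ^ (s - 1) ∂σ :=
          lintegral_mono_set (ball_subset_ball hr.1.le)
        have e3 : (D * 2 ^ (k + 1))⁻¹ ≤ r⁻¹ := inv_anti₀ hr0 hr.2
        gcongr

/-- The Hölder inequality applied to the product of a power of `u` and its reciprocal. -/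
theorem measure_rpow_le_lintegral_mul_lintegral_inv {X : Type*} [MeasurableSpace X]
    {s : ℝ} (hs : 1 < s) (μ : Measure X) {u : X → ℝ≥0∞} (hu : Measurable u)
    (hpos : ∀ᵐ x ∂μ, 0 < u x ∧ u x < ∞) (F : Set X) :
    μ F ^ (s / (s - 1)) ≤
      (∫⁻ x in F, u x ^ (s - 1) ∂μ) ^ (1 / (s - 1)) * ∫⁻ x in F, (u x)⁻¹ ∂μ := by
  have hs' : 0 < s - 1 := by linarith
  have hs0 : 0 < s := by linarith
  have hpq : s.HolderConjugate (s / (s - 1)) := Real.HolderConjugate.conjExponent hs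
  have key := ENNReal.lintegral_mul_le_Lp_mul_Lq (μ.restrict F) hpq
    (f := fun x => u x ^ ((s - 1) / s)) (g := fun x => (u x)⁻¹ ^ ((s - 1) / s))
    (by fun_prop) (by fun_prop)
  have h1 : ∫⁻ x in F, ((fun x => u x ^ ((s - 1) / s)) * fun x => (u x)⁻¹ ^ ((s - 1) / s)) x ∂μ
      = μ F := by
    rw [← setLIntegral_one]
    refine lintegral_congr_ae (ae_restrict_of_ae ?_)
    filter_upwards [hpos] with x hx
    rw [Pi.mul_apply, ← ENNReal.mul_rpow_of_nonneg _ _ (by positivity),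
      ENNReal.mul_inv_cancel hx.1.ne' hx.2.ne, ENNReal.one_rpow]
  have e1 : (s - 1) / s * s = s - 1 := by field_simp
  have e2 : (s - 1) / s * (s / (s - 1)) = 1 := by field_simp
  rw [h1] at key
  simp only [← ENNReal.rpow_mul, e1, e2, ENNReal.rpow_one] at key
  refine (ENNReal.rpow_le_rpow key (by positivity)).trans_eq ?_
  rw [ENNReal.mul_rpow_of_nonneg _ _ (by positivity), ← ENNReal.rpow_mul, ← ENNReal.rpow_mul]
  congr 2
  · field_simp
  · rw [show 1 / (s / (s - 1)) * (s / (s - 1)) = 1 by field_simp, ENNReal.rpow_one]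

/-- For a fixed point `x`, at most one shifted cube of each generation contributes, and it is
contained in a ball centred at `x`. -/
theorem tsum_indicator_shifted_dyadicCube_le (n : ℕ) {α s : ℝ} (hs : 1 < s)
    (σ : Measure (En n)) (f : En n → ℝ≥0∞) (t : En n) (E : Set (En n)) (k : ℤ) (x : En n) :
    ∑' lam : Fin n → ℤ, (((fun x => x + t) '' dyadicCube n k lam) ∩ E).indicator
        (fun _ => cQ n α s k *
          (∫⁻ y in ((fun x => x + t) '' dyadicCube n k lam) ∩ E, f y ^ (s - 1) ∂σ)
            ^ (1 / (s - 1))) x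
      ≤ cQ n α s k *
        (∫⁻ y in ball x (((n : ℝ) + 1) * 2 ^ k), f y ^ (s - 1) ∂σ) ^ (1 / (s - 1)) := by
  have hs' : 0 < s - 1 := by linarith
  by_cases h : ∃ lam, x ∈ ((fun x => x + t) '' dyadicCube n k lam) ∩ E
  · obtain ⟨lam, hx⟩ := h
    rw [tsum_eq_single lam, indicator_of_mem hx]
    · gcongr
      rintro _ ⟨⟨y, hy, rfl⟩, -⟩
      obtain ⟨⟨z, hz, rfl⟩, -⟩ := hx
      simpa [mem_ball] using dist_lt_of_mem_dyadicCube hy hz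
    · intro mu hne
      refine indicator_of_notMem (fun hmu => hne ?_) _
      obtain ⟨⟨z, hz, rfl⟩, -⟩ := hx
      obtain ⟨⟨w, hw, hwz⟩, -⟩ := hmu
      rw [add_left_injective t hwz] at hw
      exact eq_of_mem_dyadicCube hw hz
  · rw [not_exists] at h
    exact (ENNReal.tsum_eq_zero.2 fun lam => indicator_of_notMem (h lam) _).trans_le zero_le

open scoped Classical in
/-- Carleson estimate for an arbitrary family of shifted dyadic cubes whose traces on `E` lie in
a set `S`. -/
theorem tsum_cQ_mul_measure_rpow_le (n : ℕ) {α s C₀ : ℝ} (hs : 1 < s) (hαs : α * s < n)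
    (hC₀ : 0 < C₀) {σ : Measure (En n)} {u : En n → ℝ≥0∞} (hu : Measurable u)
    (hpos : ∀ᵐ x ∂σ, 0 < u x ∧ u x < ∞)
    (hsup : ∀ᵐ x ∂σ, ENNReal.ofReal C₀ * Nop n α s σ u x ≤ u x)
    (t : En n) {E S : Set (En n)} (hE : MeasurableSet E)
    (p : ℤ → (Fin n → ℤ) → Prop)
    (hp : ∀ k lam, p k lam → ((fun x => x + t) '' dyadicCube n k lam) ∩ E ⊆ S) :
    (∑' (k : ℤ), ∑' (lam : Fin n → ℤ), (if p k lam then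
        cQ n α s k * (σ (((fun x => x + t) '' dyadicCube n k lam) ∩ E)) ^ (s / (s - 1)) else 0))
      ≤ ENNReal.ofReal (C₀ * ((1 / 2) * (2 * ((n : ℝ) + 1)) ^ ((α * s - n) / (s - 1))))⁻¹
          * σ S := by
  set κ : ℝ := (1 / 2) * (2 * ((n : ℝ) + 1)) ^ ((α * s - n) / (s - 1))
  have hκ0 : 0 < κ := by positivity
  set F : ℤ → (Fin n → ℤ) → Set (En n) :=
    fun k lam => ((fun x => x + t) '' dyadicCube n k lam) ∩ E
  have hFm : ∀ k lam, MeasurableSet (F k lam) := fun k lam =>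
    ((measurableEmbedding_addRight t).measurableSet_image.2
      (measurableSet_dyadicCube n k lam)).inter hE
  set g : ℤ → (Fin n → ℤ) → ℝ≥0∞ := fun k lam =>
    cQ n α s k * (∫⁻ y in F k lam, u y ^ (s - 1) ∂σ) ^ (1 / (s - 1)) with hg
  have hterm : ∀ k lam, (if p k lam then cQ n α s k * σ (F k lam) ^ (s / (s - 1)) else 0) ≤
      ∫⁻ x in S, (F k lam).indicator (fun _ => g k lam) x * (u x)⁻¹ ∂σ := by
    intro k lam
    split_ifs with h
    · calc cQ n α s k * σ (F k lam) ^ (s / (s - 1))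
          ≤ g k lam * ∫⁻ x in F k lam, (u x)⁻¹ ∂σ := by
            rw [hg, mul_assoc]
            gcongr
            exact measure_rpow_le_lintegral_mul_lintegral_inv hs σ hu hpos _
        _ = ∫⁻ x in F k lam, (F k lam).indicator (fun _ => g k lam) x * (u x)⁻¹ ∂σ := by
            rw [← lintegral_const_mul _ (by fun_prop)]
            refine setLIntegral_congr_fun (hFm k lam) fun x hx => ?_
            simp only [indicator_of_mem hx]
        _ ≤ _ := lintegral_mono_set (hp k lam h)
    · exact zero_le
  have hmeas : ∀ k lam,
      Measurable fun x => (F k lam).indicator (fun _ => g k lam) x * (u x)⁻¹ := fun k lam =>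
    (measurable_const.indicator (hFm k lam)).mul hu.inv
  calc _ ≤ ∑' (k : ℤ), ∑' (lam : Fin n → ℤ),
        ∫⁻ x in S, (F k lam).indicator (fun _ => g k lam) x * (u x)⁻¹ ∂σ :=
        ENNReal.tsum_le_tsum fun k => ENNReal.tsum_le_tsum fun lam => hterm k lam
    _ = ∫⁻ x in S, ∑' (k : ℤ), ∑' (lam : Fin n → ℤ),
          (F k lam).indicator (fun _ => g k lam) x * (u x)⁻¹ ∂σ := by
        rw [lintegral_tsum fun k => (Measurable.tsum (hmeas k)).aemeasurable]
        exact tsum_congr fun k => (lintegral_tsum fun lam => (hmeas k lam).aemeasurable).symm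
    _ ≤ ∫⁻ _ in S, ENNReal.ofReal (C₀ * κ)⁻¹ ∂σ := by
        refine lintegral_mono_ae (ae_restrict_of_ae ?_)
        filter_upwards [hpos, hsup] with x hx hNx
        simp only [ENNReal.tsum_mul_right]
        have hsum : (∑' (k : ℤ), ∑' (lam : Fin n → ℤ), (F k lam).indicator (fun _ => g k lam) x)
            ≤ ∑' k : ℤ, cQ n α s k *
              (∫⁻ y in ball x (((n : ℝ) + 1) * 2 ^ k), u y ^ (s - 1) ∂σ) ^ (1 / (s - 1)) :=
          ENNReal.tsum_le_tsum fun k => tsum_indicator_shifted_dyadicCube_le n hs σ u t E k x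
        have hbound : ENNReal.ofReal (C₀ * κ) *
            (∑' (k : ℤ), ∑' (lam : Fin n → ℤ), (F k lam).indicator (fun _ => g k lam) x)
            ≤ u x := by
          rw [ENNReal.ofReal_mul hC₀.le, mul_assoc]
          refine le_trans ?_ hNx
          gcongr
          exact le_trans (by gcongr) (tsum_cQ_mul_le_Nop n hs hαs σ u x)
        rw [ENNReal.ofReal_inv_of_pos (by positivity), ← div_eq_mul_inv]
        refine ENNReal.div_le_of_le_mul ?_
        rw [mul_comm, ← div_eq_mul_inv, ENNReal.le_div_iff_mul_le
          (Or.inl (by positivity)) (Or.inl ENNReal.ofReal_ne_top), mul_comm]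
        exact hbound
    _ = _ := setLIntegral_const _ _

open scoped Classical in
/-- if `u` is a positive (σ-a.e. finite) solution of `u ≥ C₀ 𝒩 u` σ-a.e., then
`σ` is a discrete Carleson measure: for every shifted dyadic cube `P + t` and compact `E`,
`Σ_{Q ⊆ P} c_Q σ((Q+t) ∩ E)^{s'} ≤ C σ((P+t) ∩ E)`, and moreover
`Σ_{Q ∈ 𝒟} c_Q σ((Q+t) ∩ E)^{s'} ≤ C σ(E)`, where `s' = s/(s-1)`. -/
theorem statement1 (n : ℕ) (hn : 2 ≤ n) (α s C₀ : ℝ) (hs : 1 < s) (hα : 0 < α)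
    (hαs : α * s < n) (hC₀ : 0 < C₀) :
    ∃ C : ℝ, 0 < C ∧
      ∀ σ : Measure (En n), IsLocallyFiniteMeasure σ →
        ∀ u : En n → ℝ≥0∞, Measurable u →
          (∀ᵐ x ∂σ, 0 < u x ∧ u x < ∞) →
          (∀ᵐ x ∂σ, ENNReal.ofReal C₀ * Nop n α s σ u x ≤ u x) →
          ∀ (k' : ℤ) (lam' : Fin n → ℤ) (t : En n) (E : Set (En n)), IsCompact E →
            (∑' (k : ℤ), ∑' (lam : Fin n → ℤ),
                (if dyadicCube n k lam ⊆ dyadicCube n k' lam' then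
                  cQ n α s k * (σ (((fun x => x + t) '' dyadicCube n k lam) ∩ E)) ^ (s/(s-1))
                 else 0))
              ≤ ENNReal.ofReal C * σ (((fun x => x + t) '' dyadicCube n k' lam') ∩ E) ∧
            (∑' (k : ℤ), ∑' (lam : Fin n → ℤ),
                cQ n α s k * (σ (((fun x => x + t) '' dyadicCube n k lam) ∩ E)) ^ (s/(s-1)))
              ≤ ENNReal.ofReal C * σ E := by
  refine ⟨(C₀ * ((1 / 2) * (2 * ((n : ℝ) + 1)) ^ ((α * s - n) / (s - 1))))⁻¹,
    by positivity, ?_⟩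
  intro σ _ u hu hpos hsup k' lam' t E hE
  have hEm := hE.measurableSet
  constructor
  · refine tsum_cQ_mul_measure_rpow_le n hs hαs hC₀ hu hpos hsup t hEm
      (fun k lam => dyadicCube n k lam ⊆ dyadicCube n k' lam') fun k lam h => ?_
    gcongr
  · simpa using tsum_cQ_mul_measure_rpow_le n hs hαs hC₀ hu hpos hsup t hEm
      (fun _ _ => True) fun k lam _ => inter_subset_right
end
end

section
/- Suppose there exists a Borel measurable function u : ℝⁿ → [0,∞] with 0 < u(x) < ∞ for σ-almost every x and u(x) ≥ C₀·𝒩u(x) for σ-almost every x, where C₀ > 0. Then there exists a constant C > 0, depending only on n, α, s and C₀, such that for every compact set E ⊂ ℝⁿ and every integer m ≥ 1, ∫_E (W_{α,s}(χ_E dσ)(y))^m dσ(y) ≤ C^m · m! · σ(E). -/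
open MeasureTheory Metric Set Filter
open scoped ENNReal NNReal Topology

noncomputable section

theorem measure_univ_pow_succ_eq_lintegral_Iio (k : ℕ) (ν : Measure ℝ) [SFinite ν]
    [NullSingletonClass ν] :
    ν univ ^ (k + 1) = (k + 1) * ∫⁻ r, ν (Iio r) ^ k ∂ν := by
  induction k generalizing ν with
  | zero => simp
  | succ k ih =>
    have hmono : Monotone fun r : ℝ => ν (Iio r) := fun r t h => measure_mono (Iio_subset_Iio h)
    have hmeas : Measurable fun r : ℝ => ν (Iio r) ^ k := hmono.measurable.pow_const k
    have hsplit : ∀ r, ν univ * ν (Iio r) ^ k = ν (Iio r) ^ (k + 1) + ν (Ioi r) * ν (Iio r) ^ k := by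
      intro r
      have h : ν univ = ν (Iio r) + ν (Ioi r) := by
        rw [measure_congr (Ioi_ae_eq_Ici (a := r)), ← compl_Iio,
          measure_add_measure_compl measurableSet_Iio]
      rw [h]; ring
    have hswap : ∫⁻ r, ν (Ioi r) * ν (Iio r) ^ k ∂ν = ∫⁻ t, ∫⁻ r in Iio t, ν (Iio r) ^ k ∂ν ∂ν := by
      calc _ = ∫⁻ r, ∫⁻ t, (Ioi r).indicator (fun _ => ν (Iio r) ^ k) t ∂ν ∂ν := by
            refine lintegral_congr fun r => ?_
            rw [lintegral_indicator_const measurableSet_Ioi, mul_comm]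
        _ = ∫⁻ t, ∫⁻ r, (Ioi r).indicator (fun _ => ν (Iio r) ^ k) t ∂ν ∂ν := by
            refine lintegral_lintegral_swap (Measurable.aemeasurable ?_)
            have : Function.uncurry (fun r t : ℝ => (Ioi r).indicator (fun _ => ν (Iio r) ^ k) t)
                = {p : ℝ × ℝ | p.1 < p.2}.indicator (fun p => ν (Iio p.1) ^ k) := by
              ext ⟨r, t⟩; simp [indicator]
            rw [this]
            exact (hmeas.comp measurable_fst).indicator
              (measurableSet_lt measurable_fst measurable_snd)
        _ = _ := by
            refine lintegral_congr fun t => ?_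
            rw [← lintegral_indicator measurableSet_Iio]
            refine lintegral_congr fun r => ?_
            simp [indicator]
    have hih : ∀ t, (k + 1 : ℝ≥0∞) * ∫⁻ r in Iio t, ν (Iio r) ^ k ∂ν = ν (Iio t) ^ (k + 1) := by
      intro t
      have h := ih (ν.restrict (Iio t))
      rw [Measure.restrict_apply_univ] at h
      rw [h]
      congr 1
      refine setLIntegral_congr_fun measurableSet_Iio fun r hr => ?_
      rw [Measure.restrict_apply measurableSet_Iio, inter_eq_left.2 (Iio_subset_Iio (le_of_lt hr))]
    have hm2 : Measurable fun r : ℝ => ν (Iio r) ^ (k + 1) := hmono.measurable.pow_const _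
    have hm3 : Measurable fun t => ∫⁻ r in Iio t, ν (Iio r) ^ k ∂ν :=
      (show Monotone _ from fun r t h => lintegral_mono_set (Iio_subset_Iio h)).measurable
    calc ν univ ^ (k + 1 + 1) = (k + 1) * ∫⁻ r, ν univ * ν (Iio r) ^ k ∂ν := by
          rw [pow_succ', ih ν, lintegral_const_mul _ hmeas]; ring
      _ = (k + 1) * ∫⁻ r, ν (Iio r) ^ (k + 1) ∂ν
          + ∫⁻ t, (k + 1) * ∫⁻ r in Iio t, ν (Iio r) ^ k ∂ν ∂ν := by
          simp_rw [hsplit]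
          rw [lintegral_add_left hm2, hswap, lintegral_const_mul _ hm3, mul_add]
      _ = _ := by
          simp_rw [hih]; push_cast; ring

/-- The kernel `r ^ (-a) * r⁻¹` of a Wolff-type potential. -/
def wolffKernel (a r : ℝ) : ℝ≥0∞ := ENNReal.ofReal (r ^ (-a)) * ENNReal.ofReal r⁻¹

/-- The potential `∫_0^∞ μ(B(x,r))^q r^{-a} dr/r`. -/
def ballPotential (n : ℕ) (a q : ℝ) (μ : Measure (En n)) (x : En n) : ℝ≥0∞ :=
  ∫⁻ r in Ioi (0 : ℝ), μ (ball x r) ^ q * wolffKernel a r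

/-- The averaged energy `∫_0^∞ |B(0,r)|⁻¹ (∫ μ(B(z,2r))^{q+1} dz) r^{-a} dr/r`. -/
def ballEnergy (n : ℕ) (a q : ℝ) (μ : Measure (En n)) : ℝ≥0∞ :=
  ∫⁻ r in Ioi (0 : ℝ), wolffKernel a r *
    ((volume (ball (0 : En n) r))⁻¹ * ∫⁻ z : En n, μ (ball z (2 * r)) ^ (q + 1))

@[fun_prop]
theorem measurable_wolffKernel (a : ℝ) : Measurable (wolffKernel a) := by
  unfold wolffKernel; fun_prop

theorem measurable_measure_ball {n : ℕ} (μ : Measure (En n)) [SFinite μ] {X : Type*}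
    [MeasurableSpace X] {f : X → En n} {g : X → ℝ} (hf : Measurable f) (hg : Measurable g) :
    Measurable fun p => μ (ball (f p) (g p)) := by
  have h : MeasurableSet {p : X × En n | dist p.2 (f p.1) < g p.1} :=
    measurableSet_lt (by fun_prop) (by fun_prop)
  exact measurable_measure_prodMk_left h

theorem volume_ball_mul_lintegral {n : ℕ} (μ : Measure (En n)) [SFinite μ]
    {h : En n → ℝ≥0∞} (hh : Measurable h) (r : ℝ) :
    volume (ball (0 : En n) r) * ∫⁻ x, h x ∂μ = ∫⁻ z : En n, ∫⁻ x in ball z r, h x ∂μ := by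
  have hset : MeasurableSet {p : En n × En n | dist p.2 p.1 < r} :=
    measurableSet_lt (by fun_prop) (by fun_prop)
  calc _ = ∫⁻ x, ∫⁻ z : En n, (ball x r).indicator (fun _ => h x) z ∂volume ∂μ := by
        rw [← lintegral_const_mul _ hh]
        refine lintegral_congr fun x => ?_
        rw [lintegral_indicator_const measurableSet_ball, mul_comm,
          Measure.addHaar_ball_center volume x r]
    _ = ∫⁻ z : En n, ∫⁻ x, (ball x r).indicator (fun _ => h x) z ∂μ := by
        refine lintegral_lintegral_swap (Measurable.aemeasurable ?_)
        have : Function.uncurry (fun x z : En n => (ball x r).indicator (fun _ => h x) z)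
            = {p : En n × En n | dist p.2 p.1 < r}.indicator (fun p => h p.1) := by
          ext ⟨x, z⟩; simp [indicator]
        rw [this]
        exact (hh.comp measurable_fst).indicator hset
    _ = _ := by
        refine lintegral_congr fun z => ?_
        rw [← lintegral_indicator measurableSet_ball]
        refine lintegral_congr fun x => ?_
        simp [indicator, dist_comm]

theorem lintegral_comp_mul_wolffKernel (a : ℝ) {c : ℝ} (hc : 0 < c) {h : ℝ → ℝ≥0∞}
    (hh : Measurable h) :
    ∫⁻ r in Ioi (0 : ℝ), h (c * r) * wolffKernel a r
      = ENNReal.ofReal (c ^ a) * ∫⁻ r in Ioi (0 : ℝ), h r * wolffKernel a r := by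
  set f : ℝ → ℝ≥0∞ := (Ioi (0 : ℝ)).indicator fun r => h r * wolffKernel a r with hf
  have hfm : Measurable f := (hh.mul (measurable_wolffKernel a)).indicator measurableSet_Ioi
  have hmap : ∫⁻ r, f (c * r) = ENNReal.ofReal c⁻¹ * ∫⁻ r, f r := by
    rw [← lintegral_map hfm (measurable_const_mul c), Real.map_volume_mul_left hc.ne',
      lintegral_smul_measure, abs_of_pos (inv_pos.2 hc), smul_eq_mul]
  have hpt : ∀ r, (Ioi (0 : ℝ)).indicator (fun r => h (c * r) * wolffKernel a r) r
      = ENNReal.ofReal (c ^ a * c) * f (c * r) := by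
    intro r
    by_cases hr : 0 < r
    · have hker : wolffKernel a r = ENNReal.ofReal (c ^ a * c) * wolffKernel a (c * r) := by
        unfold wolffKernel
        rw [← ENNReal.ofReal_mul (by positivity), ← ENNReal.ofReal_mul (by positivity),
          ← ENNReal.ofReal_mul (by positivity), Real.mul_rpow hc.le hr.le, Real.rpow_neg hc.le]
        congr 1
        have := (Real.rpow_pos_of_pos hc a).ne'
        field_simp
      rw [hf, indicator_of_mem (mem_Ioi.2 hr), indicator_of_mem (mem_Ioi.2 (mul_pos hc hr)), hker]
      ring
    · rw [hf, indicator_of_notMem (by simpa using hr), indicator_of_notMem, mul_zero]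
      simpa [hc] using hr
  rw [← lintegral_indicator measurableSet_Ioi, ← lintegral_indicator measurableSet_Ioi, ← hf]
  have hfc : Measurable fun r => f (c * r) := hfm.comp (measurable_const_mul c)
  simp_rw [hpt]
  rw [lintegral_const_mul _ hfc, hmap, ← mul_assoc,
    ← ENNReal.ofReal_mul (by positivity)]
  congr 2
  field_simp

theorem measure_univ_rpow_le_lintegral_mul {Ω : Type*} [MeasurableSpace Ω] {ν : Measure Ω}
    {q : ℝ} (hq : 0 < q) {u : Ω → ℝ≥0∞} (hu : Measurable u) (hpos : ∀ᵐ x ∂ν, 0 < u x ∧ u x < ∞) :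
    ν univ ^ (q + 1) ≤ (∫⁻ x, u x ^ (1 / q) ∂ν) ^ q * ∫⁻ x, (u x)⁻¹ ∂ν := by
  have hq1 : 0 < q + 1 := by linarith
  have hconj : ((q + 1) / q).HolderConjugate (q + 1) := by
    rw [Real.holderConjugate_iff]
    refine ⟨by rw [lt_div_iff₀ hq]; linarith, by field_simp⟩
  have hH := ENNReal.lintegral_mul_le_Lp_mul_Lq ν hconj
    (f := fun x => u x ^ (1 / (q + 1))) (g := fun x => u x ^ (-(1 / (q + 1))))
    (by fun_prop) (by fun_prop)
  have h1 : ∫⁻ x, ((fun x => u x ^ (1 / (q + 1))) * fun x => u x ^ (-(1 / (q + 1)))) x ∂ν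
      = ν univ := by
    rw [← lintegral_one]
    refine lintegral_congr_ae ?_
    filter_upwards [hpos] with x hx
    simp only [Pi.mul_apply]
    rw [← ENNReal.rpow_add _ _ hx.1.ne' hx.2.ne]
    simp
  have h2 : ∀ x, (u x ^ (1 / (q + 1))) ^ ((q + 1) / q) = u x ^ (1 / q) := by
    intro x
    rw [← ENNReal.rpow_mul]
    congr 1; field_simp
  have h3 : ∀ x, (u x ^ (-(1 / (q + 1)))) ^ (q + 1) = (u x)⁻¹ := by
    intro x
    rw [← ENNReal.rpow_mul, ← ENNReal.rpow_neg_one]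
    congr 1; field_simp
  rw [h1] at hH
  simp_rw [h2, h3] at hH
  calc _ ≤ _ := ENNReal.rpow_le_rpow hH hq1.le
    _ = _ := by
      rw [ENNReal.mul_rpow_of_nonneg _ _ hq1.le, ← ENNReal.rpow_mul, ← ENNReal.rpow_mul]
      congr 2
      · field_simp
      · rw [one_div, inv_mul_cancel₀ hq1.ne', ENNReal.rpow_one]

theorem lintegral_measure_ball_rpow_le {n : ℕ} {q : ℝ} (hq : 0 < q) (μ : Measure (En n)) [SFinite μ]
    {u : En n → ℝ≥0∞} (hu : Measurable u) (hpos : ∀ᵐ x ∂μ, 0 < u x ∧ u x < ∞) (r : ℝ) :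
    ∫⁻ z : En n, μ (ball z r) ^ (q + 1)
      ≤ volume (ball (0 : En n) r) *
        ∫⁻ x, (u x)⁻¹ * (μ.withDensity fun y => u y ^ (1 / q)) (ball x (2 * r)) ^ q ∂μ := by
  set ω := μ.withDensity fun y => u y ^ (1 / q) with hω
  have hsf : SFinite ω := by rw [hω]; infer_instance
  clear_value ω
  have hball : Measurable fun x : En n => ω (ball x (2 * r)) :=
    measurable_measure_ball ω (by fun_prop) (by fun_prop)
  have hm : Measurable fun x => (u x)⁻¹ * ω (ball x (2 * r)) ^ q := hu.inv.mul (hball.pow_const q)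
  rw [volume_ball_mul_lintegral μ hm]
  refine lintegral_mono fun z => ?_
  have h := measure_univ_rpow_le_lintegral_mul hq hu (ae_restrict_of_ae (s := ball z r) hpos)
  rw [Measure.restrict_apply_univ, ← withDensity_apply _ measurableSet_ball, ← hω] at h
  refine h.trans ?_
  rw [mul_comm, ← lintegral_mul_const (ω (ball z r) ^ q) (by fun_prop)]
  refine setLIntegral_mono_ae' measurableSet_ball (Eventually.of_forall fun x hx => ?_)
  gcongr
  refine ball_subset_ball' ?_
  rw [mem_ball'] at hx
  linarith

theorem ballEnergy_le {n : ℕ} (a : ℝ) {q : ℝ} (hq : 0 < q) (μ : Measure (En n)) [SFinite μ]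
    {u : En n → ℝ≥0∞} (hu : Measurable u) (hpos : ∀ᵐ x ∂μ, 0 < u x ∧ u x < ∞) {K : ℝ≥0∞}
    (hK : ∀ᵐ x ∂μ, ballPotential n a q (μ.withDensity fun y => u y ^ (1 / q)) x ≤ K * u x) :
    ballEnergy n a q μ ≤ 2 ^ n * ENNReal.ofReal (4 ^ a) * K * μ univ := by
  set ω := μ.withDensity fun y => u y ^ (1 / q) with hω
  have hsf : SFinite ω := by rw [hω]; infer_instance
  clear_value ω
  have hball : Measurable fun p : ℝ × En n => ω (ball p.2 (4 * p.1)) :=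
    measurable_measure_ball ω (by fun_prop) (by fun_prop)
  have hjoint : Measurable fun p : ℝ × En n =>
      (u p.2)⁻¹ * (ω (ball p.2 (4 * p.1)) ^ q * wolffKernel a p.1) :=
    (hu.comp measurable_snd).inv.mul ((hball.pow_const q).mul
      ((measurable_wolffKernel a).comp measurable_fst))
  calc ballEnergy n a q μ
      ≤ ∫⁻ r in Ioi (0 : ℝ), 2 ^ n *
          ∫⁻ x, (u x)⁻¹ * (ω (ball x (4 * r)) ^ q * wolffKernel a r) ∂μ := by
        refine setLIntegral_mono_ae' measurableSet_Ioi (Eventually.of_forall fun r hr => ?_)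
        have hr' : (0 : ℝ) < r := hr
        have hV0 : volume (ball (0 : En n) r) ≠ 0 := (measure_ball_pos _ _ hr').ne'
        have hVt : volume (ball (0 : En n) r) ≠ ∞ := measure_ball_lt_top.ne
        have hV2 : volume (ball (0 : En n) (2 * r)) = 2 ^ n * volume (ball (0 : En n) r) := by
          rw [Measure.addHaar_ball_mul_of_pos _ _ two_pos, finrank_euclideanSpace_fin,
            ENNReal.ofReal_pow (by norm_num)]
          norm_num
        have h := lintegral_measure_ball_rpow_le hq μ hu hpos (2 * r)
        rw [hV2, ← hω, show 2 * (2 * r) = 4 * r by ring] at h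
        have hm : Measurable fun x : En n => (u x)⁻¹ * ω (ball x (4 * r)) ^ q :=
          hu.inv.mul ((measurable_measure_ball ω (by fun_prop) (by fun_prop)).pow_const q)
        calc _ ≤ wolffKernel a r * ((volume (ball (0 : En n) r))⁻¹ *
              (2 ^ n * volume (ball (0 : En n) r) *
                ∫⁻ x, (u x)⁻¹ * ω (ball x (4 * r)) ^ q ∂μ)) := by gcongr
          _ = ((volume (ball (0 : En n) r))⁻¹ * volume (ball (0 : En n) r)) *
              (2 ^ n * ((∫⁻ x, (u x)⁻¹ * ω (ball x (4 * r)) ^ q ∂μ) * wolffKernel a r)) := by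
                ring
          _ = _ := by
            rw [ENNReal.inv_mul_cancel hV0 hVt, one_mul,
              ← lintegral_mul_const _ hm]
            simp_rw [mul_assoc]
    _ = 2 ^ n * ∫⁻ x, ∫⁻ r in Ioi (0 : ℝ),
          (u x)⁻¹ * (ω (ball x (4 * r)) ^ q * wolffKernel a r) ∂volume ∂μ := by
        rw [lintegral_const_mul _ hjoint.lintegral_prod_right']
        congr 1
        exact lintegral_lintegral_swap hjoint.aemeasurable
    _ ≤ 2 ^ n * ∫⁻ x, ENNReal.ofReal (4 ^ a) * K ∂μ := by
        refine mul_le_mul_right (lintegral_mono_ae ?_) _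
        filter_upwards [hpos, hK] with x hx hKx
        have hball : Measurable fun r : ℝ => ω (ball x r) ^ q :=
          (measurable_measure_ball ω (by fun_prop) (by fun_prop)).pow_const q
        have hm : Measurable fun r : ℝ => ω (ball x (4 * r)) ^ q * wolffKernel a r :=
          (hball.comp (measurable_const_mul 4)).mul (measurable_wolffKernel a)
        rw [lintegral_const_mul _ hm,
          lintegral_comp_mul_wolffKernel a four_pos hball]
        calc _ ≤ (u x)⁻¹ * (ENNReal.ofReal (4 ^ a) * (K * u x)) := by gcongr; exact hKx
          _ = ((u x)⁻¹ * u x) * (ENNReal.ofReal (4 ^ a) * K) := by ring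
          _ = _ := by rw [ENNReal.inv_mul_cancel hx.1.ne' hx.2.ne, one_mul]
    _ = _ := by rw [lintegral_const]; ring

theorem lintegral_ballPotential_pow_succ {n : ℕ} (a q : ℝ) (μ : Measure (En n)) [SFinite μ]
    (k : ℕ) (x : En n) :
    ballPotential n a q μ x ^ (k + 1) = (k + 1) * ∫⁻ r in Ioi (0 : ℝ),
      μ (ball x r) ^ q * wolffKernel a r *
        (∫⁻ t in Ioo (0 : ℝ) r, μ (ball x t) ^ q * wolffKernel a t) ^ k := by
  set g : ℝ → ℝ≥0∞ := fun r => μ (ball x r) ^ q * wolffKernel a r with hg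
  have hgm : Measurable g :=
    ((measurable_measure_ball μ (by fun_prop) (by fun_prop)).pow_const q).mul
      (measurable_wolffKernel a)
  set ν := (volume.restrict (Ioi (0 : ℝ))).withDensity g with hν
  have hNA : NullSingletonClass ν := inferInstance
  have hIio : ∀ r, ν (Iio r) = ∫⁻ t in Ioo (0 : ℝ) r, g t := by
    intro r
    rw [hν, withDensity_apply _ measurableSet_Iio, Measure.restrict_restrict measurableSet_Iio,
      inter_comm, Ioi_inter_Iio]
  have hmono : Monotone fun r : ℝ => ν (Iio r) := fun r t h => measure_mono (Iio_subset_Iio h)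
  have h := measure_univ_pow_succ_eq_lintegral_Iio k ν
  rw [hν, lintegral_withDensity_eq_lintegral_mul _ hgm (hmono.measurable.pow_const k), ← hν] at h
  simp_rw [Pi.mul_apply, hIio] at h
  rw [← h, hν, withDensity_apply _ MeasurableSet.univ, Measure.restrict_univ]
  rfl

theorem lintegral_measure_ball_rpow_mul_le {n : ℕ} {q : ℝ} (hq : 0 < q) (a : ℝ)
    (σ : Measure (En n)) [SFinite σ] {F : Set (En n)} (hF : MeasurableSet F) (k : ℕ) {D : ℝ≥0∞}
    (hD : ∀ G, MeasurableSet G →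
      ∫⁻ x in G, ballPotential n a q (σ.restrict G) x ^ k ∂σ ≤ D * σ G) (z : En n) (r : ℝ) :
    ∫⁻ x in ball z r, σ.restrict F (ball x r) ^ q *
        (∫⁻ t in Ioo (0 : ℝ) r, σ.restrict F (ball x t) ^ q * wolffKernel a t) ^ k ∂σ.restrict F
      ≤ D * σ.restrict F (ball z (2 * r)) ^ (q + 1) := by
  rcases le_or_gt r 0 with hr | hr
  · simp [ball_eq_empty.2 hr]
  set μ := σ.restrict F with hμ
  set G := ball z (2 * r) ∩ F with hG
  have hGm : MeasurableSet G := measurableSet_ball.inter hF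
  have hσG : σ G = μ (ball z (2 * r)) := by rw [hμ, Measure.restrict_apply measurableSet_ball]
  have hsub : ∀ x ∈ ball z r, ∀ t ≤ r, ball x t ⊆ ball z (2 * r) := by
    intro x hx t ht
    refine ball_subset_ball' ?_
    rw [mem_ball] at hx
    linarith
  have hjoint : Measurable fun p : En n × ℝ =>
      σ.restrict G (ball p.1 p.2) ^ q * wolffKernel a p.2 :=
    ((measurable_measure_ball _ measurable_fst measurable_snd).pow_const q).mul
      ((measurable_wolffKernel a).comp measurable_snd)
  have hpot : Measurable (ballPotential n a q (σ.restrict G)) :=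
    hjoint.lintegral_prod_right'
  have htrunc : ∀ x ∈ ball z r, ∫⁻ t in Ioo (0 : ℝ) r, μ (ball x t) ^ q * wolffKernel a t
      ≤ ballPotential n a q (σ.restrict G) x := by
    intro x hx
    refine le_trans (setLIntegral_mono_ae' measurableSet_Ioo (Eventually.of_forall fun t ht => ?_))
      (lintegral_mono_set Ioo_subset_Ioi_self)
    rw [hμ, Measure.restrict_apply measurableSet_ball, Measure.restrict_apply measurableSet_ball]
    gcongr ?_ ^ _ * _
    exact measure_mono (subset_inter inter_subset_left
      (inter_subset_inter_left _ (hsub x hx t ht.2.le)))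
  calc _ ≤ ∫⁻ x in ball z r, μ (ball z (2 * r)) ^ q *
          ballPotential n a q (σ.restrict G) x ^ k ∂μ := by
        refine setLIntegral_mono_ae' measurableSet_ball (Eventually.of_forall fun x hx => ?_)
        gcongr
        · exact hsub x hx r le_rfl
        · exact htrunc x hx
    _ ≤ ∫⁻ x in ball z (2 * r), μ (ball z (2 * r)) ^ q *
          ballPotential n a q (σ.restrict G) x ^ k ∂μ :=
        lintegral_mono_set (ball_subset_ball (by linarith))
    _ = μ (ball z (2 * r)) ^ q * ∫⁻ x in G, ballPotential n a q (σ.restrict G) x ^ k ∂σ := by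
        rw [lintegral_const_mul _ (hpot.pow_const k), hμ,
          Measure.restrict_restrict measurableSet_ball]
    _ ≤ μ (ball z (2 * r)) ^ q * (D * μ (ball z (2 * r))) := by
        rw [← hσG]
        gcongr
        exact hD G hGm
    _ = _ := by
        rw [ENNReal.rpow_add_of_nonneg _ _ hq.le zero_le_one, ENNReal.rpow_one]; ring

theorem measurable_setLIntegral_Ioo {X : Type*} [MeasurableSpace X] {f : X × ℝ → ℝ≥0∞}
    (hf : Measurable f) (b : ℝ) :
    Measurable fun p : X × ℝ => ∫⁻ t in Ioo b p.2, f (p.1, t) := by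
  have hset : MeasurableSet {p : (X × ℝ) × ℝ | b < p.2 ∧ p.2 < p.1.2} :=
    (measurableSet_lt measurable_const measurable_snd).inter
      (measurableSet_lt measurable_snd (by fun_prop))
  have hf' : Measurable fun p : (X × ℝ) × ℝ => f (p.1.1, p.2) := by fun_prop
  convert (hf'.indicator hset).lintegral_prod_right' (ν := volume) using 1
  ext p
  rw [← lintegral_indicator measurableSet_Ioo]
  refine lintegral_congr fun t => ?_
  simp [indicator]

theorem setLIntegral_ballPotential_pow_le {n : ℕ} (a : ℝ) {q : ℝ} (hq : 0 < q) (σ : Measure (En n))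
    [SFinite σ] {K : ℝ≥0∞}
    (hK : ∀ F, MeasurableSet F → ballEnergy n a q (σ.restrict F) ≤ K * σ F) (m : ℕ)
    {F : Set (En n)} (hF : MeasurableSet F) :
    ∫⁻ x in F, ballPotential n a q (σ.restrict F) x ^ m ∂σ ≤ K ^ m * m.factorial * σ F := by
  induction m generalizing F with
  | zero => simp
  | succ k ih =>
    have hz := lintegral_measure_ball_rpow_mul_le hq a σ hF k (fun G hG => ih hG)
    have hKF := hK F hF
    set μ := σ.restrict F with hμ
    have hsf : SFinite μ := by rw [hμ]; infer_instance
    clear_value μ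
    have hmg : Measurable fun p : En n × ℝ => μ (ball p.1 p.2) ^ q * wolffKernel a p.2 :=
      ((measurable_measure_ball μ measurable_fst measurable_snd).pow_const q).mul
        ((measurable_wolffKernel a).comp measurable_snd)
    set T : En n → ℝ → ℝ≥0∞ := fun x r =>
      ∫⁻ t in Ioo (0 : ℝ) r, μ (ball x t) ^ q * wolffKernel a t
    have hTm : Measurable fun p : En n × ℝ => T p.1 p.2 := measurable_setLIntegral_Ioo hmg 0
    have hpow := lintegral_ballPotential_pow_succ a q μ k
    change ∀ x, _ = _ * ∫⁻ r in Ioi (0 : ℝ), _ * T x r ^ k at hpow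
    change ∀ z r, ∫⁻ x in ball z r, _ * T x r ^ k ∂μ ≤ _ at hz
    clear_value T
    have hjoint : Measurable fun p : En n × ℝ =>
        μ (ball p.1 p.2) ^ q * wolffKernel a p.2 * T p.1 p.2 ^ k := hmg.mul (hTm.pow_const k)
    have hball2 : Measurable fun p : ℝ × En n => μ (ball p.2 (2 * p.1)) ^ (q + 1) :=
      (measurable_measure_ball μ (by fun_prop) (by fun_prop)).pow_const _
    have hslice : ∀ r : ℝ, 0 < r → ∫⁻ x, μ (ball x r) ^ q * wolffKernel a r * T x r ^ k ∂μ
        ≤ K ^ k * k.factorial * (wolffKernel a r * ((volume (ball (0 : En n) r))⁻¹ *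
          ∫⁻ z : En n, μ (ball z (2 * r)) ^ (q + 1))) := by
      intro r hr
      have hV0 : volume (ball (0 : En n) r) ≠ 0 := (measure_ball_pos _ _ hr).ne'
      have hVt : volume (ball (0 : En n) r) ≠ ∞ := measure_ball_lt_top.ne
      have hhm : Measurable fun x => μ (ball x r) ^ q * T x r ^ k := by
        have hTr : Measurable fun x => T x r := hTm.comp (measurable_id.prodMk measurable_const)
        exact ((measurable_measure_ball μ (by fun_prop) (by fun_prop)).pow_const q).mul
          (hTr.pow_const k)
      have hb : Measurable fun z : En n => μ (ball z (2 * r)) ^ (q + 1) :=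
        (measurable_measure_ball μ (by fun_prop) (by fun_prop)).pow_const _
      have havg := volume_ball_mul_lintegral μ hhm r
      calc _ = wolffKernel a r * ∫⁻ x, μ (ball x r) ^ q * T x r ^ k ∂μ := by
            rw [← lintegral_const_mul _ hhm]
            exact lintegral_congr fun x => by ring
        _ = wolffKernel a r * ((volume (ball (0 : En n) r))⁻¹ *
              ∫⁻ z : En n, ∫⁻ x in ball z r, μ (ball x r) ^ q * T x r ^ k ∂μ) := by
            rw [← havg, ← mul_assoc (volume (ball (0 : En n) r))⁻¹,
              ENNReal.inv_mul_cancel hV0 hVt, one_mul]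
        _ ≤ wolffKernel a r * ((volume (ball (0 : En n) r))⁻¹ *
              ∫⁻ z : En n, K ^ k * k.factorial * μ (ball z (2 * r)) ^ (q + 1)) := by
            refine mul_le_mul_right (mul_le_mul_right (lintegral_mono fun z => ?_) _) _
            exact hz z r
        _ = _ := by rw [lintegral_const_mul _ hb]; ring
    have henergy : Measurable fun r : ℝ => wolffKernel a r * ((volume (ball (0 : En n) r))⁻¹ *
        ∫⁻ z : En n, μ (ball z (2 * r)) ^ (q + 1)) := by
      have hb : Measurable fun r : ℝ => ∫⁻ z : En n, μ (ball z (2 * r)) ^ (q + 1) :=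
        hball2.lintegral_prod_right'
      have hV : Measurable fun r : ℝ => volume (ball (0 : En n) r) :=
        measurable_measure_ball volume (by fun_prop) (by fun_prop)
      exact (measurable_wolffKernel a).mul (hV.inv.mul hb)
    calc ∫⁻ x, ballPotential n a q μ x ^ (k + 1) ∂μ
        = (k + 1) * ∫⁻ x, ∫⁻ r in Ioi (0 : ℝ),
            μ (ball x r) ^ q * wolffKernel a r * T x r ^ k ∂volume ∂μ := by
          rw [← lintegral_const_mul _ hjoint.lintegral_prod_right']
          exact lintegral_congr fun x => hpow x
      _ = (k + 1) * ∫⁻ r in Ioi (0 : ℝ), ∫⁻ x,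
            μ (ball x r) ^ q * wolffKernel a r * T x r ^ k ∂μ := by
          congr 1
          exact lintegral_lintegral_swap hjoint.aemeasurable
      _ ≤ (k + 1) * (K ^ k * k.factorial * ballEnergy n a q μ) := by
          rw [ballEnergy, ← lintegral_const_mul _ henergy]
          refine mul_le_mul_right ?_ _
          exact setLIntegral_mono_ae' measurableSet_Ioi (Eventually.of_forall hslice)
      _ ≤ (k + 1) * (K ^ k * k.factorial * (K * σ F)) := by gcongr
      _ = _ := by
          rw [Nat.factorial_succ]; push_cast; ring

theorem wolff_eq_ballPotential (n : ℕ) (α : ℝ) {s : ℝ} (hs : 1 < s) (μ : Measure (En n))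
    (x : En n) :
    wolff n α s μ x = ballPotential n (((n : ℝ) - α * s) / (s - 1)) (1 / (s - 1)) μ x := by
  have hs' : 0 < s - 1 := by linarith
  refine setLIntegral_congr_fun measurableSet_Ioi fun r hr => ?_
  have hr' : (0 : ℝ) < r := hr
  simp only [wolffKernel]
  rw [← mul_assoc, ENNReal.div_rpow_of_nonneg _ _ (by positivity),
    ENNReal.ofReal_rpow_of_pos (by positivity), div_eq_mul_inv,
    ← ENNReal.ofReal_inv_of_pos (by positivity), ← Real.rpow_mul hr'.le, ← Real.rpow_neg hr'.le]
  congr 5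
  field_simp

theorem Nop_eq_ballPotential (n : ℕ) (α : ℝ) {s : ℝ} (hs : 1 < s) (σ : Measure (En n))
    (u : En n → ℝ≥0∞) (x : En n) :
    Nop n α s σ u x = ballPotential n (((n : ℝ) - α * s) / (s - 1)) (1 / (s - 1))
      (σ.withDensity fun y => u y ^ (s - 1)) x := by
  have hs' : 0 < s - 1 := by linarith
  refine setLIntegral_congr_fun measurableSet_Ioi fun r hr => ?_
  have hr' : (0 : ℝ) < r := hr
  simp only [wolffKernel]
  rw [← mul_assoc, ENNReal.mul_rpow_of_nonneg _ _ (by positivity),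
    ENNReal.ofReal_rpow_of_pos (by positivity), withDensity_apply _ measurableSet_ball,
    ← Real.rpow_mul hr'.le, mul_comm (ENNReal.ofReal _)]
  congr 4
  field_simp
  ring

/-- if `u` is a positive (σ-a.e. finite) solution of `u ≥ C₀ 𝒩 u` σ-a.e., then
there is `C = C(n,α,s,C₀) > 0` with `∫_E (W_{α,s}(χ_E dσ))^m dσ ≤ C^m m! σ(E)` for every
compact `E` and integer `m ≥ 1`. -/
theorem statement2 (n : ℕ) (hn : 2 ≤ n) (α s C₀ : ℝ) (hs : 1 < s) (hα : 0 < α)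
    (hαs : α * s < n) (hC₀ : 0 < C₀) :
    ∃ C : ℝ, 0 < C ∧
      ∀ σ : Measure (En n), IsLocallyFiniteMeasure σ →
        ∀ u : En n → ℝ≥0∞, Measurable u →
          (∀ᵐ x ∂σ, 0 < u x ∧ u x < ∞) →
          (∀ᵐ x ∂σ, ENNReal.ofReal C₀ * Nop n α s σ u x ≤ u x) →
          ∀ E : Set (En n), IsCompact E → ∀ m : ℕ, 1 ≤ m →
            ∫⁻ y in E, (wolff n α s (σ.restrict E) y) ^ m ∂σ
              ≤ ENNReal.ofReal C ^ m * (m.factorial : ℝ≥0∞) * σ E := by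
  have hs' : 0 < s - 1 := by linarith
  have hq : 0 < 1 / (s - 1) := by positivity
  set q := 1 / (s - 1) with hqdef
  set a := ((n : ℝ) - α * s) / (s - 1) with ha
  refine ⟨2 ^ n * 4 ^ a * C₀⁻¹, by positivity, ?_⟩
  intro σ hσ u hu hpos hsuper E hE m _
  have hC : ENNReal.ofReal (2 ^ n * 4 ^ a * C₀⁻¹)
      = 2 ^ n * ENNReal.ofReal (4 ^ a) * (ENNReal.ofReal C₀)⁻¹ := by
    rw [ENNReal.ofReal_mul (by positivity), ENNReal.ofReal_mul (by positivity),
      ENNReal.ofReal_pow (by norm_num), ENNReal.ofReal_inv_of_pos hC₀]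
    norm_num
  simp_rw [wolff_eq_ballPotential n α hs]
  rw [hC]
  refine setLIntegral_ballPotential_pow_le a hq σ (fun F hF => ?_) m hE.measurableSet
  rw [← Measure.restrict_apply_univ (μ := σ) F]
  refine ballEnergy_le a hq (σ.restrict F) hu (ae_restrict_of_ae hpos) ?_
  filter_upwards [ae_restrict_of_ae hsuper] with x hx
  rw [Nop_eq_ballPotential n α hs] at hx
  have hqinv : 1 / q = s - 1 := by rw [hqdef, one_div_one_div]
  rw [hqinv]
  refine le_trans (setLIntegral_mono_ae' measurableSet_Ioi (Eventually.of_forall fun r _ => ?_))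
    ((ENNReal.mul_le_iff_le_inv (by simpa using hC₀) ENNReal.ofReal_ne_top).1 hx)
  gcongr ?_ ^ _ * _
  rw [withDensity_apply _ measurableSet_ball, withDensity_apply _ measurableSet_ball]
  exact lintegral_mono' (Measure.restrict_mono_measure Measure.restrict_le_self _) le_rfl
end
end

section
/- Let x₀ ∈ ℝⁿ and C₀ > 0, and let u : ℝⁿ → [0,∞] be a Borel measurable function satisfying u(x) ≥ C₀·𝒩u(x) + C₀·|x−x₀|^{(αs−n)/(s−1)} for all x ∈ ℝⁿ. Then there exists a constant c > 0, depending only on n, α, s and C₀, such that for all x ∈ ℝⁿ, u(x) ≥ c·|x−x₀|^{(αs−n)/(s−1)} · exp( c ∫_0^{|x−x₀|} (σ(B(x,r))/r^{n−αs})^{1/(s−1)} dr/r ) · exp( c ∫_0^{|x−x₀|} (σ(B(x₀,r))/r^{n−αs}) dr/r ). -/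
open MeasureTheory Metric Set Filter
open scoped ENNReal NNReal Topology

noncomputable section

theorem eexp_eq_tsum (a : ℝ≥0∞) :
    eexp a = ∑' k : ℕ, a ^ k * ((k.factorial : ℝ≥0∞))⁻¹ := by
  by_cases ha : a = ∞
  · subst ha
    rw [eexp, if_pos rfl]
    refine (top_le_iff.mp ?_).symm
    refine le_trans ?_ (ENNReal.le_tsum 1)
    simp
  · rw [eexp, if_neg ha, Real.exp_eq_exp_ℝ, NormedSpace.exp_eq_tsum_div]
    have h0 : ∀ k : ℕ, 0 ≤ a.toReal ^ k / (k.factorial : ℝ) := fun k => by positivity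
    rw [ENNReal.ofReal_tsum_of_nonneg h0 (Real.summable_pow_div_factorial _)]
    refine tsum_congr fun k => ?_
    rw [ENNReal.ofReal_div_of_pos (by positivity), ENNReal.ofReal_pow ENNReal.toReal_nonneg,
      ENNReal.ofReal_toReal ha, ENNReal.ofReal_natCast, div_eq_mul_inv]

theorem eexp_mono {a b : ℝ≥0∞} (h : a ≤ b) : eexp a ≤ eexp b := by
  rw [eexp_eq_tsum, eexp_eq_tsum]
  exact ENNReal.tsum_le_tsum fun k => by gcongr

theorem eexp_ne_zero (a : ℝ≥0∞) : eexp a ≠ 0 := by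
  unfold eexp
  split_ifs
  · simp
  · simp [Real.exp_pos]

theorem eexp_add (a b : ℝ≥0∞) : eexp (a + b) = eexp a * eexp b := by
  by_cases ha : a = ∞
  · subst ha
    rw [top_add, eexp, if_pos rfl, ENNReal.top_mul (eexp_ne_zero b)]
  by_cases hb : b = ∞
  · subst hb
    rw [add_top, show eexp ∞ = ∞ from if_pos rfl, ENNReal.mul_top (eexp_ne_zero a)]
  rw [eexp, eexp, eexp, if_neg ha, if_neg hb, if_neg (ENNReal.add_ne_top.mpr ⟨ha, hb⟩),
    ENNReal.toReal_add ha hb, Real.exp_add, ENNReal.ofReal_mul (Real.exp_pos _).le]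

theorem eexp_rpow (a : ℝ≥0∞) {q : ℝ} (hq : 0 < q) :
    (eexp a) ^ q = eexp (ENNReal.ofReal q * a) := by
  by_cases ha : a = ∞
  · subst ha
    rw [ENNReal.mul_top (by simpa using hq), show eexp ∞ = ∞ from if_pos rfl,
      ENNReal.top_rpow_of_pos hq]
  rw [eexp, eexp, if_neg ha, if_neg (ENNReal.mul_ne_top ENNReal.ofReal_ne_top ha),
    ENNReal.ofReal_rpow_of_pos (Real.exp_pos _), ENNReal.toReal_mul,
    ENNReal.toReal_ofReal hq.le, ← Real.exp_mul, mul_comm]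

section Gronwall

variable {X : Type*} [MeasurableSpace X]

/-- The measure of chains `ρ yₖ ≤ ⋯ ≤ ρ y₁ ≤ t`, as an iterated integral. -/
noncomputable def chainIntegral (ν : Measure X) (ρ : X → ℝ) : ℕ → ℝ → ℝ≥0∞
  | 0, _ => 1
  | k + 1, t => ∫⁻ y in {y | ρ y ≤ t}, chainIntegral ν ρ k (ρ y) ∂ν

theorem chainIntegral_mono (ν : Measure X) (ρ : X → ℝ) (k : ℕ) :
    Monotone (chainIntegral ν ρ k) := by
  cases k with
  | zero => exact fun _ _ _ => le_rfl
  | succ k => exact fun a b hab => lintegral_mono_set fun y (hy : ρ y ≤ a) => hy.trans hab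

theorem measurable_chainIntegral (ν : Measure X) {ρ : X → ℝ} (hρ : Measurable ρ) (k : ℕ) :
    Measurable fun y => chainIntegral ν ρ k (ρ y) :=
  (chainIntegral_mono ν ρ k).measurable.comp hρ

theorem measure_mul_chainIntegral_le (ν : Measure X) [SFinite ν] {ρ : X → ℝ} (hρ : Measurable ρ)
    (k : ℕ) (t : ℝ) :
    ν {y | ρ y ≤ t} * chainIntegral ν ρ k t ≤ (k + 1 : ℕ) * chainIntegral ν ρ (k + 1) t := by
  induction k generalizing t with
  | zero => simp [chainIntegral]
  | succ k ih =>
    have hm : ∀ t, MeasurableSet {y | ρ y ≤ t} := fun t => measurableSet_le hρ measurable_const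
    set H := fun y => chainIntegral ν ρ k (ρ y) with hH
    have hHm : Measurable H := measurable_chainIntegral ν hρ k
    have h1 : ν {y | ρ y ≤ t} * chainIntegral ν ρ (k + 1) t
        = ∫⁻ y in {y | ρ y ≤ t}, ν {z | ρ z ≤ t} * H y ∂ν := by
      rw [lintegral_const_mul _ hHm]; rfl
    have h2 : ∀ y ∈ {y | ρ y ≤ t}, ν {z | ρ z ≤ t} * H y
        ≤ (k + 1 : ℕ) * chainIntegral ν ρ (k + 1) (ρ y)
          + ∫⁻ z in {z | ρ z ≤ t}, {z | ρ y ≤ ρ z}.indicator (fun _ => H y) z ∂ν := by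
      intro y hy
      have hsub : {z | ρ z ≤ t} ⊆ {z | ρ z ≤ ρ y} ∪ ({z | ρ y ≤ ρ z} ∩ {z | ρ z ≤ t}) := by
        intro z hz
        rcases le_total (ρ z) (ρ y) with h | h
        · exact Or.inl h
        · exact Or.inr ⟨h, hz⟩
      calc ν {z | ρ z ≤ t} * H y
          ≤ (ν {z | ρ z ≤ ρ y} + ν ({z | ρ y ≤ ρ z} ∩ {z | ρ z ≤ t})) * H y := by
            gcongr; exact (measure_mono hsub).trans (measure_union_le _ _)
        _ = ν {z | ρ z ≤ ρ y} * chainIntegral ν ρ k (ρ y)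
            + ν ({z | ρ y ≤ ρ z} ∩ {z | ρ z ≤ t}) * H y := add_mul _ _ _
        _ ≤ _ := by
            refine add_le_add (ih _) ?_
            have hm' : MeasurableSet {z | ρ y ≤ ρ z} := measurableSet_le measurable_const hρ
            rw [lintegral_indicator hm', setLIntegral_const, Measure.restrict_apply hm', mul_comm]
    have h3 : ∫⁻ y in {y | ρ y ≤ t}, ∫⁻ z in {z | ρ z ≤ t},
          {z | ρ y ≤ ρ z}.indicator (fun _ => H y) z ∂ν ∂ν
        ≤ chainIntegral ν ρ (k + 2) t := by
      rw [lintegral_lintegral_swap]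
      · refine lintegral_mono fun z => ?_
        have : (fun y => {z | ρ y ≤ ρ z}.indicator (fun _ => H y) z)
            = {y | ρ y ≤ ρ z}.indicator H := by
          ext y; simp [Set.indicator]
        rw [this, lintegral_indicator (hm _)]
        exact lintegral_mono' (Measure.restrict_mono le_rfl Measure.restrict_le_self) le_rfl
      · have hS : MeasurableSet {q : X × X | ρ q.1 ≤ ρ q.2} :=
          measurableSet_le (hρ.comp measurable_fst) (hρ.comp measurable_snd)
        exact ((hHm.comp measurable_fst).indicator hS).aemeasurable
    calc ν {y | ρ y ≤ t} * chainIntegral ν ρ (k + 1) t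
        ≤ ∫⁻ y in {y | ρ y ≤ t}, ((k + 1 : ℕ) * chainIntegral ν ρ (k + 1) (ρ y)
          + ∫⁻ z in {z | ρ z ≤ t}, {z | ρ y ≤ ρ z}.indicator (fun _ => H y) z ∂ν) ∂ν := by
          rw [h1]; exact setLIntegral_mono' (hm t) h2
      _ = (k + 1 : ℕ) * chainIntegral ν ρ (k + 2) t
          + ∫⁻ y in {y | ρ y ≤ t}, ∫⁻ z in {z | ρ z ≤ t},
            {z | ρ y ≤ ρ z}.indicator (fun _ => H y) z ∂ν ∂ν := by
          rw [lintegral_add_left ((measurable_chainIntegral ν hρ (k + 1)).const_mul _),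
            lintegral_const_mul _ (measurable_chainIntegral ν hρ (k + 1))]
          rfl
      _ ≤ (k + 1 : ℕ) * chainIntegral ν ρ (k + 2) t + chainIntegral ν ρ (k + 2) t := by gcongr
      _ = (k + 1 + 1 : ℕ) * chainIntegral ν ρ (k + 1 + 1) t := by push_cast; ring

theorem measure_pow_le_factorial_mul_chainIntegral (ν : Measure X) [SFinite ν] {ρ : X → ℝ}
    (hρ : Measurable ρ) (k : ℕ) (t : ℝ) :
    ν {y | ρ y ≤ t} ^ k ≤ k.factorial * chainIntegral ν ρ k t := by
  induction k with
  | zero => simp [chainIntegral]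
  | succ k ih =>
    calc ν {y | ρ y ≤ t} ^ (k + 1) = ν {y | ρ y ≤ t} ^ k * ν {y | ρ y ≤ t} := pow_succ _ _
      _ ≤ k.factorial * chainIntegral ν ρ k t * ν {y | ρ y ≤ t} := by gcongr
      _ = k.factorial * (ν {y | ρ y ≤ t} * chainIntegral ν ρ k t) := by ring
      _ ≤ k.factorial * ((k + 1 : ℕ) * chainIntegral ν ρ (k + 1) t) := by
        exact mul_le_mul' le_rfl (measure_mul_chainIntegral_le ν hρ k t)
      _ = _ := by rw [Nat.factorial_succ]; push_cast; ring

/-- A reverse Gronwall inequality along the sublevel sets of `ρ`; the measure may have atoms. -/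
theorem mul_eexp_le_of_gronwall (μ : Measure X) [SFinite μ] {ρ : X → ℝ} (hρ : Measurable ρ)
    {w : X → ℝ≥0∞} (hw : Measurable w) {f : X → ℝ≥0∞} (c K : ℝ≥0∞)
    (hf : ∀ᵐ x ∂μ, c * w x * (K + ∫⁻ y in {y | ρ y ≤ ρ x}, f y ∂μ) ≤ f x) (t : ℝ) :
    K * eexp (c * ∫⁻ y in {y | ρ y ≤ t}, w y ∂μ) ≤ K + ∫⁻ y in {y | ρ y ≤ t}, f y ∂μ := by
  have hm : ∀ t, MeasurableSet {y | ρ y ≤ t} := fun t => measurableSet_le hρ measurable_const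
  set ν := μ.withDensity w with hν
  have key : ∀ (N : ℕ) (t : ℝ), K * ∑ k ∈ Finset.range N, c ^ k * chainIntegral ν ρ k t
      ≤ K + ∫⁻ y in {y | ρ y ≤ t}, f y ∂μ := by
    intro N
    induction N with
    | zero => intro t; simp
    | succ N ih =>
      intro t
      rw [Finset.sum_range_succ', mul_add, add_comm]
      refine add_le_add (by simp [chainIntegral]) ?_
      have hmeas : ∀ k : ℕ, Measurable fun y => c ^ k * chainIntegral ν ρ k (ρ y) :=
        fun k => (measurable_chainIntegral ν hρ k).const_mul _
      calc K * ∑ k ∈ Finset.range N, c ^ (k + 1) * chainIntegral ν ρ (k + 1) t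
          = ∫⁻ y in {y | ρ y ≤ t},
              K * c * ∑ k ∈ Finset.range N, c ^ k * chainIntegral ν ρ k (ρ y) ∂ν := by
            rw [lintegral_const_mul _ (Finset.measurable_fun_sum _ fun k _ => hmeas k),
              lintegral_finsetSum _ fun k _ => hmeas k, mul_assoc]
            congr 1
            rw [Finset.mul_sum]
            refine Finset.sum_congr rfl fun k _ => ?_
            rw [lintegral_const_mul _ (measurable_chainIntegral ν hρ k), pow_succ', mul_assoc]
            rfl
        _ = ∫⁻ y in {y | ρ y ≤ t},
              w y * (K * c * ∑ k ∈ Finset.range N, c ^ k * chainIntegral ν ρ k (ρ y)) ∂μ := by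
            rw [hν, restrict_withDensity (hm t), lintegral_withDensity_eq_lintegral_mul _ hw
              ((Finset.measurable_fun_sum _ fun k _ => hmeas k).const_mul _)]
            rfl
        _ ≤ ∫⁻ y in {y | ρ y ≤ t}, f y ∂μ := by
            refine lintegral_mono_ae ((ae_restrict_of_ae hf).mono fun y hy => ?_)
            refine le_trans ?_ hy
            calc _ = c * w y * (K * ∑ k ∈ Finset.range N, c ^ k * chainIntegral ν ρ k (ρ y)) := by
                  ring
              _ ≤ _ := by gcongr; exact ih _
  have hνt : ν {y | ρ y ≤ t} = ∫⁻ y in {y | ρ y ≤ t}, w y ∂μ := withDensity_apply _ (hm t)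
  rw [← hνt, eexp_eq_tsum, ← ENNReal.tsum_mul_left]
  refine ENNReal.tsum_le_of_sum_range_le fun N => ?_
  refine le_trans ?_ (key N t)
  rw [Finset.mul_sum]
  refine Finset.sum_le_sum fun k _ => ?_
  refine mul_le_mul' le_rfl ?_
  rw [mul_pow, mul_assoc]
  refine mul_le_mul' le_rfl ?_
  rw [mul_comm, ENNReal.inv_mul_le_iff (by simp [Nat.factorial_ne_zero]) (by simp)]
  exact measure_pow_le_factorial_mul_chainIntegral ν hρ k t

end Gronwall

section WolffOperator

variable {E : Type*} [PseudoMetricSpace E] [MeasurableSpace E]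

/-- The operator `f ↦ W(f^p dσ)`, where the radius carries the exponent `-β`. -/
noncomputable def wolffOp (β p : ℝ) (σ : Measure E) (f : E → ℝ≥0∞) (x : E) : ℝ≥0∞ :=
  ∫⁻ r in Ioi (0:ℝ),
    (ENNReal.ofReal (r ^ (-β)) * ∫⁻ y in ball x r, (f y) ^ p ∂σ) ^ (1 / p) * ENNReal.ofReal r⁻¹

/-- The constant in `rpow_setLIntegral_le_of_wolffOp_le`. -/
noncomputable def wolffConst (β p C : ℝ) : ℝ := (C * (2⁻¹ * (4:ℝ) ^ (-(β / p)))) ^ p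

theorem wolffConst_pos (β p : ℝ) {C : ℝ} (hC : 0 < C) : 0 < wolffConst β p C := by
  unfold wolffConst; positivity

theorem ofReal_rpow_neg_mul_rpow {β p r : ℝ} (hp : 0 < p) (hr : 0 < r) (Z : ℝ≥0∞) :
    (ENNReal.ofReal (r ^ (-β)) * Z) ^ (1 / p) = ENNReal.ofReal (r ^ (-(β / p))) * Z ^ (1 / p) := by
  rw [ENNReal.mul_rpow_of_nonneg _ _ (by positivity), ENNReal.ofReal_rpow_of_pos (by positivity),
    ← Real.rpow_mul hr.le]
  congr 3
  ring

theorem mul_rpow_setLIntegral_le_wolffOp {β p : ℝ} (hβ : 0 < β) (hp : 0 < p) (σ : Measure E)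
    (f : E → ℝ≥0∞) {x z : E} {R : ℝ} (hR : 0 < R) (hx : dist x z ≤ R) :
    ENNReal.ofReal (2⁻¹ * (4:ℝ) ^ (-(β / p)) * R ^ (-(β / p)))
      * (∫⁻ y in ball z R, (f y) ^ p ∂σ) ^ (1 / p) ≤ wolffOp β p σ f x := by
  set Z := ∫⁻ y in ball z R, (f y) ^ p ∂σ
  have hβp : 0 < β / p := by positivity
  calc ENNReal.ofReal (2⁻¹ * (4:ℝ) ^ (-(β / p)) * R ^ (-(β / p))) * Z ^ (1 / p)
      = ∫⁻ _ in Ioo (2 * R) (4 * R),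
          ENNReal.ofReal ((4 * R) ^ (-(β / p))) * Z ^ (1 / p) * ENNReal.ofReal (4 * R)⁻¹ := by
        rw [setLIntegral_const, Real.volume_Ioo, mul_assoc _ _ (ENNReal.ofReal (4 * R - 2 * R)),
          ← ENNReal.ofReal_mul (by positivity), mul_right_comm (ENNReal.ofReal _),
          ← ENNReal.ofReal_mul (by positivity)]
        congr 2
        rw [Real.mul_rpow (by norm_num) hR.le]
        field_simp
        ring
    _ ≤ ∫⁻ r in Ioo (2 * R) (4 * R),
          (ENNReal.ofReal (r ^ (-β)) * ∫⁻ y in ball x r, (f y) ^ p ∂σ) ^ (1 / p)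
            * ENNReal.ofReal r⁻¹ := by
        refine setLIntegral_mono' measurableSet_Ioo fun r hr => ?_
        have hr0 : 0 < r := lt_trans (by positivity) hr.1
        rw [ofReal_rpow_neg_mul_rpow hp hr0]
        have hsub : ball z R ⊆ ball x r := by
          refine ball_subset_ball' ?_
          rw [dist_comm]; linarith [hr.1]
        refine mul_le_mul' (mul_le_mul' (ENNReal.ofReal_le_ofReal ?_) ?_)
          (ENNReal.ofReal_le_ofReal ?_)
        · exact Real.rpow_le_rpow_of_nonpos hr0 hr.2.le (by linarith)
        · exact ENNReal.rpow_le_rpow (lintegral_mono_set hsub) (by positivity)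
        · exact inv_anti₀ hr0 hr.2.le
    _ ≤ wolffOp β p σ f x :=
        lintegral_mono_set fun r hr => lt_trans (by positivity) hr.1

theorem rpow_setLIntegral_le_of_wolffOp_le {β p C : ℝ} (hβ : 0 < β) (hp : 0 < p) (hC : 0 < C)
    {σ : Measure E} {u : E → ℝ≥0∞} {x z : E} (hu : ENNReal.ofReal C * wolffOp β p σ u x ≤ u x)
    {R : ℝ} (hR : 0 < R) (hx : dist x z ≤ R) :
    ENNReal.ofReal (wolffConst β p C * R ^ (-β)) * ∫⁻ y in ball z R, (u y) ^ p ∂σ ≤ u x ^ p := by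
  have h := (mul_le_mul' le_rfl (mul_rpow_setLIntegral_le_wolffOp hβ hp σ u hR hx)).trans hu
  refine le_trans (le_of_eq ?_) (ENNReal.rpow_le_rpow h hp.le)
  rw [ENNReal.mul_rpow_of_nonneg _ _ hp.le, ENNReal.mul_rpow_of_nonneg _ _ hp.le,
    ← ENNReal.rpow_mul, one_div_mul_cancel hp.ne', ENNReal.rpow_one, ← mul_assoc,
    ENNReal.ofReal_rpow_of_pos hC, ENNReal.ofReal_rpow_of_pos (by positivity),
    ← ENNReal.ofReal_mul (by positivity)]
  congr 2
  rw [wolffConst, Real.mul_rpow (x := C) hC.le (by positivity),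
    Real.mul_rpow (x := 2⁻¹ * (4:ℝ) ^ (-(β / p))) (by positivity) (by positivity),
    ← Real.rpow_mul hR.le, neg_mul, div_mul_cancel₀ _ hp.ne', mul_assoc]

theorem eq_top_or_measure_ball_le [OpensMeasurableSpace E] {β p C : ℝ} (hβ : 0 < β) (hp : 0 < p)
    (hC : 0 < C) {σ : Measure E} {u : E → ℝ≥0∞} (hum : Measurable u) (hu0 : ∀ y, u y ≠ 0)
    (hu : ∀ y, ENNReal.ofReal C * wolffOp β p σ u y ≤ u y) (x : E) {R : ℝ} (hR : 0 < R) :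
    u x = ∞ ∨ σ (ball x R) ≤ ENNReal.ofReal ((wolffConst β p C)⁻¹ * R ^ β) := by
  set Z := ∫⁻ y in ball x R, (u y) ^ p ∂σ with hZ
  have hc := wolffConst_pos β p hC
  set a := wolffConst β p C * R ^ (-β) with ha
  have ha0 : 0 < a := by positivity
  have key : ∀ y ∈ ball x R, ENNReal.ofReal a * Z ≤ u y ^ p := fun y hy =>
    rpow_setLIntegral_le_of_wolffOp_le hβ hp hC (hu y) hR (le_of_lt hy)
  have hinv : ENNReal.ofReal ((wolffConst β p C)⁻¹ * R ^ β) = (ENNReal.ofReal a)⁻¹ := by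
    rw [← ENNReal.ofReal_inv_of_pos ha0, ha, mul_inv, Real.rpow_neg hR.le, inv_inv]
  rw [hinv]
  by_cases hZt : Z = ∞
  · left
    have := key x (mem_ball_self hR)
    rw [hZt, ENNReal.mul_top (by simpa using ha0), top_le_iff,
      ENNReal.rpow_eq_top_iff_of_pos hp] at this
    exact this
  right
  by_cases hσ : σ (ball x R) = 0
  · rw [hσ]; exact zero_le
  have hZ0 : Z ≠ 0 := by
    rw [hZ, Ne, lintegral_eq_zero_iff (hum.pow_const p)]
    intro h
    refine hσ ?_
    have : (ae (σ.restrict (ball x R))) = ⊥ := by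
      rw [← Filter.eventually_false_iff_eq_bot]
      filter_upwards [h] with y hy
      rw [Pi.zero_apply, ENNReal.rpow_eq_zero_iff_of_pos hp] at hy
      exact hu0 y hy
    rwa [ae_eq_bot, Measure.restrict_eq_zero] at this
  have h1 : ENNReal.ofReal a * Z * σ (ball x R) ≤ Z := by
    rw [← setLIntegral_const, hZ]
    exact setLIntegral_mono' measurableSet_ball key
  rw [ENNReal.le_inv_iff_mul_le]
  have h2 : σ (ball x R) * ENNReal.ofReal a * Z ≤ 1 * Z := by
    rw [one_mul]; refine le_trans (le_of_eq ?_) h1; ring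
  exact (ENNReal.mul_le_mul_iff_left hZ0 hZt).mp h2

theorem lintegral_Ioi_eq_two_mul (g : ℝ → ℝ≥0∞) :
    ∫⁻ r in Ioi (0:ℝ), g r = ∫⁻ t in Ioi (0:ℝ), 2 * g (2 * t) := by
  have himg : (fun t : ℝ => 2 * t) '' Ioi 0 = Ioi 0 := by
    rw [image_mul_left_Ioi (by norm_num)]; simp
  have h := lintegral_image_eq_lintegral_abs_deriv_mul (s := Ioi (0:ℝ)) (f := fun t => 2 * t)
    (f' := fun _ => 2) measurableSet_Ioi
    (fun t _ => by simpa using ((hasDerivAt_id t).const_mul 2).hasDerivWithinAt)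
    (fun a _ b _ hab => by simpa using hab) g
  rw [himg] at h
  simpa using h

/-- The density in the truncated Wolff potential. -/
noncomputable def wolffDensity (β p : ℝ) (σ : Measure E) (x : E) (t : ℝ) : ℝ≥0∞ :=
  (σ (ball x t) / ENNReal.ofReal (t ^ β)) ^ (1 / p) * ENNReal.ofReal t⁻¹

theorem measurable_wolffDensity (β p : ℝ) (σ : Measure E) (x : E) :
    Measurable (wolffDensity β p σ x) := by
  have h : Measurable fun t : ℝ => σ (ball x t) :=
    Monotone.measurable fun a b hab => measure_mono (ball_subset_ball hab)
  exact ((h.div (by fun_prop)).pow_const _).mul (by fun_prop)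

theorem setLIntegral_iInf_mul_wolffDensity_le_wolffOp [OpensMeasurableSpace E] {β p : ℝ}
    (hp : 0 < p) (σ : Measure E) (u : E → ℝ≥0∞) {x y : E} {T : ℝ} (hy : dist y x ≤ T) :
    ENNReal.ofReal ((2:ℝ) ^ (-(β / p))) *
      ∫⁻ t in Ioi 0 ∩ Ici T, (⨅ z ∈ ball x t, u z) * wolffDensity β p σ x t
      ≤ wolffOp β p σ u y := by
  rw [wolffOp, lintegral_Ioi_eq_two_mul, ← lintegral_const_mul' _ _ ENNReal.ofReal_ne_top]
  refine le_trans (setLIntegral_mono' (measurableSet_Ioi.inter measurableSet_Ici) ?_)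
    (lintegral_mono_set inter_subset_left)
  rintro t ⟨ht : 0 < t, hTt : T ≤ t⟩
  set m := ⨅ z ∈ ball x t, u z with hm
  have hsub : ball x t ⊆ ball y (2 * t) := by
    refine ball_subset_ball' ?_
    rw [dist_comm]; linarith
  have hZ : m ^ p * σ (ball x t) ≤ ∫⁻ z in ball y (2 * t), (u z) ^ p ∂σ := by
    rw [← setLIntegral_const]
    refine le_trans (setLIntegral_mono' measurableSet_ball fun z hz => ?_) (lintegral_mono_set hsub)
    exact ENNReal.rpow_le_rpow (iInf₂_le z hz) hp.le
  have h2 : (2:ℝ≥0∞) * ENNReal.ofReal (2 * t)⁻¹ = ENNReal.ofReal t⁻¹ := by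
    rw [show (2:ℝ≥0∞) = ENNReal.ofReal 2 by simp, ← ENNReal.ofReal_mul (by norm_num)]
    congr 1
    field_simp
  rw [ofReal_rpow_neg_mul_rpow hp (by positivity), mul_left_comm (2:ℝ≥0∞), h2]
  refine le_trans (le_of_eq ?_) (mul_le_mul' (mul_le_mul' le_rfl
    (ENNReal.rpow_le_rpow hZ (by positivity))) le_rfl)
  rw [wolffDensity, Real.mul_rpow (by norm_num) ht.le, ENNReal.ofReal_mul (by positivity),
    ENNReal.mul_rpow_of_nonneg _ _ (by positivity), ← ENNReal.rpow_mul, mul_one_div_cancel hp.ne',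
    ENNReal.rpow_one, ENNReal.div_eq_inv_mul, ← ENNReal.ofReal_inv_of_pos (by positivity),
    ← Real.rpow_neg ht.le, ofReal_rpow_neg_mul_rpow hp ht]
  ring

theorem mul_eexp_wolff_le [OpensMeasurableSpace E] {β p C : ℝ} (hp : 0 < p) (hC : 0 < C)
    {σ : Measure E} {u : E → ℝ≥0∞} (hu : ∀ y, ENNReal.ofReal C * wolffOp β p σ u y ≤ u y)
    {x : E} {R : ℝ} (hR : 0 < R) {K : ℝ≥0∞} (hK : ∀ y ∈ ball x R, K ≤ u y) {c : ℝ}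
    (hc1 : c ≤ 1 / 2) (hc2 : c ≤ C * (2:ℝ) ^ (-(β / p)) / 2) :
    ENNReal.ofReal c * (K * eexp (ENNReal.ofReal c * ∫⁻ t in Ioo 0 R, wolffDensity β p σ x t))
      ≤ u x := by
  set f : ℝ → ℝ≥0∞ := fun t => (⨅ z ∈ ball x t, u z) * wolffDensity β p σ x t with hf
  have step : ∀ (T : ℝ) (y : E), y ∈ ball x R → dist y x ≤ T →
      ENNReal.ofReal c * (K + ∫⁻ t in {t | -t ≤ -T}, f t ∂(volume.restrict (Ioo 0 R))) ≤ u y := by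
    intro T y hyR hyT
    have hset : {t : ℝ | -t ≤ -T} = Ici T := by ext t; simp
    rw [hset, Measure.restrict_restrict measurableSet_Ici, mul_add]
    have h1 : ENNReal.ofReal c * K ≤ ENNReal.ofReal (1 / 2) * u y :=
      mul_le_mul' (ENNReal.ofReal_le_ofReal hc1) (hK y hyR)
    have h2 : ENNReal.ofReal c * ∫⁻ t in Ici T ∩ Ioo 0 R, f t ≤ ENNReal.ofReal (1 / 2) * u y := by
      calc ENNReal.ofReal c * ∫⁻ t in Ici T ∩ Ioo 0 R, f t
          ≤ ENNReal.ofReal (C * (2:ℝ) ^ (-(β / p)) / 2) * ∫⁻ t in Ioi 0 ∩ Ici T, f t :=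
            mul_le_mul' (ENNReal.ofReal_le_ofReal hc2)
              (lintegral_mono_set fun t ht => ⟨ht.2.1, ht.1⟩)
        _ = ENNReal.ofReal (1 / 2) * (ENNReal.ofReal C * (ENNReal.ofReal ((2:ℝ) ^ (-(β / p)))
              * ∫⁻ t in Ioi 0 ∩ Ici T, f t)) := by
            rw [← mul_assoc (ENNReal.ofReal C), ← ENNReal.ofReal_mul hC.le, ← mul_assoc,
              ← ENNReal.ofReal_mul (by norm_num)]
            congr 2
            ring
        _ ≤ ENNReal.ofReal (1 / 2) * u y :=
            mul_le_mul' le_rfl ((mul_le_mul' le_rfl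
              (setLIntegral_iInf_mul_wolffDensity_le_wolffOp hp σ u hyT)).trans (hu y))
    refine (add_le_add h1 h2).trans (le_of_eq ?_)
    rw [← add_mul, ← ENNReal.ofReal_add (by norm_num) (by norm_num)]
    norm_num
  have hg := mul_eexp_le_of_gronwall (volume.restrict (Ioo 0 R)) (ρ := fun t => -t)
    measurable_neg (measurable_wolffDensity β p σ x) (f := f) (ENNReal.ofReal c) K ?_ (-0)
  · have hset : {t : ℝ | -t ≤ -0} = Ici 0 := by ext t; simp
    have hset' : Ici (0:ℝ) ∩ Ioo 0 R = Ioo 0 R := inter_eq_right.mpr fun t ht => ht.1.le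
    have hx := step 0 x (mem_ball_self hR) (by simp)
    refine le_trans (mul_le_mul' le_rfl ?_) hx
    refine le_trans (le_of_eq ?_) hg
    rw [hset, Measure.restrict_restrict measurableSet_Ici, hset']
  · refine ae_restrict_of_forall_mem measurableSet_Ioo fun t ht => ?_
    rw [mul_right_comm]
    refine mul_le_mul' (le_iInf₂ fun y hy => ?_) le_rfl
    exact step t y (ball_subset_ball ht.2.le hy) (le_of_lt hy)

theorem mul_rpow_dist_mul_one_add_le_rpow {β p C : ℝ} (hβ : 0 < β) (hp : 0 < p) (hC : 0 < C)
    {σ : Measure E} {u : E → ℝ≥0∞} {x₀ : E}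
    (hu : ∀ y, ENNReal.ofReal C * wolffOp β p σ u y ≤ u y)
    (hu' : ∀ y, ENNReal.ofReal C * ENNReal.ofReal (dist y x₀) ^ (-(β / p)) ≤ u y) {a : ℝ}
    (ha : 0 ≤ a) (ha1 : a ≤ C ^ p / 2) (ha2 : a ≤ wolffConst β p C * (3:ℝ) ^ (-β) / 2) (x : E) :
    ENNReal.ofReal a * ENNReal.ofReal (dist x x₀) ^ (-β)
      * (1 + ∫⁻ y in {y | dist y x₀ ≤ 2 * dist x x₀}, u y ^ p ∂σ) ≤ u x ^ p := by
  have hβp : 0 < β / p := by positivity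
  rcases (dist_nonneg (x := x) (y := x₀)).eq_or_lt with h0 | hd
  · have h := hu' x
    rw [← h0, ENNReal.ofReal_zero, ENNReal.zero_rpow_of_neg (by linarith),
      ENNReal.mul_top (by simpa using hC), top_le_iff] at h
    rw [h, ENNReal.top_rpow_of_pos hp]
    exact le_top
  have hw := wolffConst_pos β p hC
  set d := dist x x₀
  rw [mul_add, mul_one]
  have h1 : ENNReal.ofReal a * ENNReal.ofReal d ^ (-β) ≤ ENNReal.ofReal (1 / 2) * u x ^ p := by
    refine le_trans ?_ (mul_le_mul' le_rfl (ENNReal.rpow_le_rpow (hu' x) hp.le))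
    rw [ENNReal.mul_rpow_of_nonneg _ _ hp.le, ← ENNReal.rpow_mul, neg_mul,
      div_mul_cancel₀ _ hp.ne', ENNReal.ofReal_rpow_of_pos hC, ← mul_assoc,
      ← ENNReal.ofReal_mul (by norm_num)]
    refine mul_le_mul' (ENNReal.ofReal_le_ofReal ?_) le_rfl
    linarith
  have h2 : ENNReal.ofReal a * ENNReal.ofReal d ^ (-β)
      * ∫⁻ y in {y | dist y x₀ ≤ 2 * d}, u y ^ p ∂σ ≤ ENNReal.ofReal (1 / 2) * u x ^ p := by
    have hx : dist x x₀ ≤ 3 * d := by linarith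
    refine le_trans ?_ (mul_le_mul' le_rfl
      (rpow_setLIntegral_le_of_wolffOp_le hβ hp hC (hu x) (by positivity) hx))
    rw [← mul_assoc, ENNReal.ofReal_rpow_of_pos hd, ← ENNReal.ofReal_mul ha,
      ← ENNReal.ofReal_mul' (by positivity)]
    refine mul_le_mul' (ENNReal.ofReal_le_ofReal ?_) (lintegral_mono_set fun y hy => ?_)
    · rw [Real.mul_rpow (by norm_num) hd.le]
      have := mul_le_mul_of_nonneg_right ha2 (Real.rpow_nonneg hd.le (-β))
      linarith
    · have : dist y x₀ ≤ 2 * d := hy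
      rw [mem_ball]; linarith
  refine (add_le_add h1 h2).trans (le_of_eq ?_)
  rw [← add_mul, ← ENNReal.ofReal_add (by norm_num) (by norm_num)]
  norm_num

end WolffOperator

section PoleEstimate

variable {E : Type*} [PseudoMetricSpace E] [MeasurableSpace E] [OpensMeasurableSpace E]

theorem ofReal_mul_setLIntegral_Ioi_le {β : ℝ} (hβ : 0 < β) {a : ℝ} (ha : 0 ≤ a) :
    ENNReal.ofReal β * ∫⁻ r in Ioi a, ENNReal.ofReal (r ^ (-β - 1))
      ≤ ENNReal.ofReal a ^ (-β) := by
  rcases ha.eq_or_lt with rfl | ha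
  · simp [ENNReal.zero_rpow_of_neg, hβ]
  have hb : -β - 1 < -1 := by linarith
  rw [← ofReal_integral_eq_lintegral_ofReal (integrableOn_Ioi_rpow_of_lt hb ha)
    (ae_restrict_of_forall_mem measurableSet_Ioi fun r (hr : a < r) =>
      Real.rpow_nonneg (ha.trans hr).le _),
    integral_Ioi_rpow_of_lt hb ha, ← ENNReal.ofReal_mul hβ.le, ENNReal.ofReal_rpow_of_pos ha]
  refine ENNReal.ofReal_le_ofReal (le_of_eq ?_)
  rw [sub_add_cancel]
  field_simp

theorem ofReal_mul_riesz_le {β : ℝ} (hβ : 0 < β) (σ : Measure E) [SFinite σ] (x₀ : E) (T : ℝ) :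
    ENNReal.ofReal β * ∫⁻ r in Ioo 0 T,
        (σ (ball x₀ r) / ENNReal.ofReal (r ^ β)) * ENNReal.ofReal r⁻¹
      ≤ ∫⁻ y in {y | dist y x₀ ≤ T}, ENNReal.ofReal (dist y x₀) ^ (-β) ∂σ := by
  have hd : Measurable fun y : E => dist y x₀ := (continuous_id.dist continuous_const).measurable
  set g : ℝ → ℝ≥0∞ := fun r => ENNReal.ofReal (r ^ (-β - 1)) with hg
  have hgm : Measurable g := by fun_prop
  have h1 : ∀ r ∈ Ioo 0 T, (σ (ball x₀ r) / ENNReal.ofReal (r ^ β)) * ENNReal.ofReal r⁻¹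
      = ∫⁻ y in {y | dist y x₀ ≤ T}, (Ioi (dist y x₀)).indicator g r ∂σ := by
    intro r hr
    have hsub : ball x₀ r ∩ {y | dist y x₀ ≤ T} = ball x₀ r :=
      inter_eq_left.mpr fun y (hy : dist y x₀ < r) => (hy.trans hr.2).le
    have : (fun y => (Ioi (dist y x₀)).indicator g r)
        = (ball x₀ r).indicator fun _ => g r := by
      ext y; simp [Set.indicator]
    rw [this, lintegral_indicator measurableSet_ball, setLIntegral_const,
      Measure.restrict_apply measurableSet_ball, hsub, ENNReal.div_eq_inv_mul, mul_right_comm,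
      ← ENNReal.ofReal_inv_of_pos (Real.rpow_pos_of_pos hr.1 _),
      ← ENNReal.ofReal_mul (by have := hr.1; positivity), hg]
    congr 2
    rw [Real.rpow_sub_one hr.1.ne', Real.rpow_neg hr.1.le, div_eq_mul_inv]
  have hmeas : Measurable fun q : ℝ × E => (Ioi (dist q.2 x₀)).indicator g q.1 := by
    have hS : MeasurableSet {q : ℝ × E | dist q.2 x₀ < q.1} :=
      measurableSet_lt (hd.comp measurable_snd) measurable_fst
    exact (hgm.comp measurable_fst).indicator hS
  rw [setLIntegral_congr_fun measurableSet_Ioo h1, lintegral_lintegral_swap hmeas.aemeasurable,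
    ← lintegral_const_mul' _ _ ENNReal.ofReal_ne_top]
  refine lintegral_mono fun y => ?_
  refine le_trans (mul_le_mul' le_rfl ?_) (ofReal_mul_setLIntegral_Ioi_le hβ dist_nonneg)
  rw [lintegral_indicator measurableSet_Ioi]
  exact lintegral_mono' (Measure.restrict_mono le_rfl Measure.restrict_le_self) le_rfl

theorem mul_eexp_riesz_le {β p C : ℝ} (hβ : 0 < β) (hp : 0 < p) (hC : 0 < C)
    {σ : Measure E} [SFinite σ] {u : E → ℝ≥0∞} {x₀ : E}
    (hu : ∀ y, ENNReal.ofReal C * wolffOp β p σ u y ≤ u y)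
    (hu' : ∀ y, ENNReal.ofReal C * ENNReal.ofReal (dist y x₀) ^ (-(β / p)) ≤ u y) {a : ℝ}
    (ha : 0 < a) (ha1 : a ≤ C ^ p / 2) (ha2 : a ≤ wolffConst β p C * (3:ℝ) ^ (-β) / 2) (x : E)
    {T : ℝ} (hT : T ≤ 2 * dist x x₀) :
    ENNReal.ofReal (a ^ (1 / p)) * ENNReal.ofReal (dist x x₀) ^ (-(β / p))
      * eexp (ENNReal.ofReal (1 / p * a * β) * ∫⁻ r in Ioo 0 T,
        (σ (ball x₀ r) / ENNReal.ofReal (r ^ β)) * ENNReal.ofReal r⁻¹) ≤ u x := by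
  have hd : Measurable fun y : E => dist y x₀ := (continuous_id.dist continuous_const).measurable
  set I := ∫⁻ r in Ioo 0 T, (σ (ball x₀ r) / ENNReal.ofReal (r ^ β)) * ENNReal.ofReal r⁻¹
  have step := mul_rpow_dist_mul_one_add_le_rpow hβ hp hC hu hu' ha.le ha1 ha2
  have hsub : ∀ y : E, {z | dist z x₀ ≤ dist y x₀} ⊆ {z | dist z x₀ ≤ 2 * dist y x₀} :=
    fun y z (hz : dist z x₀ ≤ dist y x₀) => show dist z x₀ ≤ 2 * dist y x₀ by
      linarith [dist_nonneg (x := y) (y := x₀)]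
  have hg := mul_eexp_le_of_gronwall σ hd (w := fun y => ENNReal.ofReal (dist y x₀) ^ (-β))
    (by fun_prop) (f := fun y => u y ^ p) (ENNReal.ofReal a) 1
    (Eventually.of_forall fun y => le_trans (mul_le_mul' le_rfl (add_le_add le_rfl
      (lintegral_mono_set (hsub y))))
      (step y)) (2 * dist x x₀)
  rw [one_mul] at hg
  have hI : ENNReal.ofReal (a * β) * I ≤ ENNReal.ofReal a *
      ∫⁻ y in {y | dist y x₀ ≤ 2 * dist x x₀}, ENNReal.ofReal (dist y x₀) ^ (-β) ∂σ := by
    rw [ENNReal.ofReal_mul ha.le, mul_assoc]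
    exact mul_le_mul' le_rfl ((ofReal_mul_riesz_le hβ σ x₀ T).trans
      (lintegral_mono_set fun z hz => le_trans hz hT))
  have h := (mul_le_mul' le_rfl ((eexp_mono hI).trans hg)).trans (step x)
  have h' := ENNReal.rpow_le_rpow h (z := 1 / p) (by positivity)
  rw [← ENNReal.rpow_mul, mul_one_div_cancel hp.ne', ENNReal.rpow_one,
    ENNReal.mul_rpow_of_nonneg _ _ (by positivity), ENNReal.mul_rpow_of_nonneg _ _ (by positivity),
    eexp_rpow _ (by positivity), ← ENNReal.rpow_mul, ENNReal.ofReal_rpow_of_pos ha,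
    ← mul_assoc (ENNReal.ofReal (1 / p)), ← ENNReal.ofReal_mul (by positivity), ← mul_assoc,
    neg_mul, mul_one_div] at h'
  exact h'

end PoleEstimate

section LowerBound

variable {E : Type*} [PseudoMetricSpace E] [MeasurableSpace E] [OpensMeasurableSpace E]

theorem eq_top_or_wolff_two_mul_le {β p C : ℝ} (hβ : 0 < β) (hp : 0 < p)
    (hC : 0 < C) {σ : Measure E} {u : E → ℝ≥0∞} (hum : Measurable u) (hu0 : ∀ y, u y ≠ 0)
    (hu : ∀ y, ENNReal.ofReal C * wolffOp β p σ u y ≤ u y) (x : E) {R : ℝ} (hR : 0 < R) :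
    u x = ∞ ∨ ∫⁻ t in Ioo 0 (2 * R), wolffDensity β p σ x t
      ≤ (∫⁻ t in Ioo 0 R, wolffDensity β p σ x t)
        + ENNReal.ofReal ((wolffConst β p C)⁻¹ ^ (1 / p)) := by
  by_cases htop : u x = ∞
  · exact Or.inl htop
  right
  have hc := wolffConst_pos β p hC
  have hunion : Ioo 0 (2 * R) = Ioo 0 R ∪ Ico R (2 * R) :=
    (Ioo_union_Ico_eq_Ioo hR (by linarith)).symm
  rw [hunion]
  refine (lintegral_union_le _ _ _).trans (add_le_add le_rfl ?_)
  have hbound : ∀ t ∈ Ico R (2 * R), wolffDensity β p σ x t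
      ≤ ENNReal.ofReal ((wolffConst β p C)⁻¹ ^ (1 / p) * R⁻¹) := by
    intro t ht
    have ht0 : 0 < t := hR.trans_le ht.1
    have hball := (eq_top_or_measure_ball_le hβ hp hC hum hu0 hu x ht0).resolve_left htop
    have hdiv : σ (ball x t) / ENNReal.ofReal (t ^ β)
        ≤ ENNReal.ofReal (wolffConst β p C)⁻¹ := by
      refine ENNReal.div_le_of_le_mul ?_
      rwa [← ENNReal.ofReal_mul (by positivity)]
    rw [wolffDensity, ENNReal.ofReal_mul (by positivity),
      ← ENNReal.ofReal_rpow_of_pos (inv_pos.mpr hc)]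
    refine mul_le_mul' (ENNReal.rpow_le_rpow hdiv (by positivity)) (ENNReal.ofReal_le_ofReal ?_)
    exact inv_anti₀ hR ht.1
  refine (setLIntegral_mono' measurableSet_Ico hbound).trans (le_of_eq ?_)
  rw [setLIntegral_const, Real.volume_Ico, ← ENNReal.ofReal_mul (by positivity)]
  congr 1
  field_simp
  ring

theorem exists_lower_bound {β p C : ℝ} (hβ : 0 < β) (hp : 0 < p) (hC : 0 < C) :
    ∃ c : ℝ, 0 < c ∧ ∀ (σ : Measure E) [SFinite σ] (x₀ : E) (u : E → ℝ≥0∞), Measurable u →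
      (∀ x, ENNReal.ofReal C * wolffOp β p σ u x
        + ENNReal.ofReal C * ENNReal.ofReal (dist x x₀) ^ (-(β / p)) ≤ u x) →
      ∀ x, ENNReal.ofReal c * ENNReal.ofReal (dist x x₀) ^ (-(β / p))
        * eexp (ENNReal.ofReal c * ∫⁻ t in Ioo 0 (dist x x₀), wolffDensity β p σ x t)
        * eexp (ENNReal.ofReal c * ∫⁻ r in Ioo 0 (dist x x₀),
          (σ (ball x₀ r) / ENNReal.ofReal (r ^ β)) * ENNReal.ofReal r⁻¹) ≤ u x := by
  have hw := wolffConst_pos β p hC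
  have hβp : 0 < β / p := by positivity
  obtain ⟨a, ha, ha'⟩ : ∃ a : ℝ, 0 < a ∧
      a ≤ min (C ^ p / 2) (wolffConst β p C * (3:ℝ) ^ (-β) / 2) := ⟨_, by positivity, le_rfl⟩
  obtain ⟨b, hb, hb'⟩ : ∃ b : ℝ, 0 < b ∧ b ≤ min (1 / 2) (C * (2:ℝ) ^ (-(β / p)) / 2) :=
    ⟨_, by positivity, le_rfl⟩
  set M := (wolffConst β p C)⁻¹ ^ (1 / p) with hM
  obtain ⟨c, hc, hc'⟩ : ∃ c : ℝ, 0 < c ∧ c ≤ min (min b (1 / p * a * β))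
      (b * (a ^ (1 / p) * (2:ℝ) ^ (-(β / p))) / Real.exp (b * M)) := ⟨_, by positivity, le_rfl⟩
  simp only [le_min_iff] at ha' hb' hc'
  obtain ⟨⟨hcb, hca⟩, hce⟩ := hc'
  refine ⟨c, hc, fun σ _ x₀ u hum hux x => ?_⟩
  have hu : ∀ y, ENNReal.ofReal C * wolffOp β p σ u y ≤ u y :=
    fun y => le_self_add.trans (hux y)
  have hu' : ∀ y, ENNReal.ofReal C * ENNReal.ofReal (dist y x₀) ^ (-(β / p)) ≤ u y :=
    fun y => le_add_self.trans (hux y)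
  have hu0 : ∀ y, u y ≠ 0 := by
    intro y hy
    have h := hu' y
    rw [hy, nonpos_iff_eq_zero, mul_eq_zero, ENNReal.rpow_eq_zero_iff] at h
    rcases h with h | h | h
    · exact absurd (ENNReal.ofReal_eq_zero.mp h) (by linarith)
    · linarith [h.2]
    · exact ENNReal.ofReal_ne_top h.1
  by_cases htop : u x = ∞
  · rw [htop]; exact le_top
  set d := dist x x₀ with hd
  have hd0 : 0 < d := by
    refine lt_of_le_of_ne dist_nonneg fun h0 => htop ?_
    have h := hu' x
    rw [← hd, ← h0, ENNReal.ofReal_zero, ENNReal.zero_rpow_of_neg (by linarith),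
      ENNReal.mul_top (by simpa using hC), top_le_iff] at h
    exact h
  set D := ENNReal.ofReal d ^ (-(β / p)) with hD
  set I := ∫⁻ r in Ioo 0 d, (σ (ball x₀ r) / ENNReal.ofReal (r ^ β)) * ENNReal.ofReal r⁻¹
  set W := ∫⁻ t in Ioo 0 (d / 2), wolffDensity β p σ x t
  have hW : ∫⁻ t in Ioo 0 d, wolffDensity β p σ x t ≤ W + ENNReal.ofReal M := by
    have h := (eq_top_or_wolff_two_mul_le hβ hp hC hum hu0 hu x (half_pos hd0)).resolve_left htop
    rwa [mul_div_cancel₀ d two_ne_zero] at h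
  set K := ENNReal.ofReal (a ^ (1 / p) * (2:ℝ) ^ (-(β / p))) * D
    * eexp (ENNReal.ofReal (1 / p * a * β) * I) with hK
  have hKu : ∀ y ∈ ball x (d / 2), K ≤ u y := by
    intro y hy
    have hy' : dist y x < d / 2 := hy
    have hlow : d ≤ 2 * dist y x₀ := by
      have := dist_triangle_left x x₀ y
      linarith
    have hupp : dist y x₀ ≤ 2 * d := by
      have := dist_triangle y x x₀
      linarith
    refine le_trans ?_ (mul_eexp_riesz_le hβ hp hC hu hu' ha ha'.1 ha'.2 y hlow)
    refine mul_le_mul' ?_ le_rfl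
    rw [ENNReal.ofReal_mul (by positivity), mul_assoc]
    refine mul_le_mul' le_rfl ?_
    rw [hD, ENNReal.ofReal_rpow_of_pos hd0, ENNReal.ofReal_rpow_of_pos (by linarith),
      ← ENNReal.ofReal_mul (by positivity), ← Real.mul_rpow (by norm_num) hd0.le]
    exact ENNReal.ofReal_le_ofReal
      (Real.rpow_le_rpow_of_nonpos (by linarith) hupp (by linarith))
  have hmain := mul_eexp_wolff_le hp hC hu (half_pos hd0) hKu hb'.1 hb'.2
  refine le_trans ?_ hmain
  have hexp : eexp (ENNReal.ofReal c * ∫⁻ t in Ioo 0 d, wolffDensity β p σ x t)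
      ≤ eexp (ENNReal.ofReal b * W) * ENNReal.ofReal (Real.exp (b * M)) := by
    have hbM : ENNReal.ofReal (Real.exp (b * M)) = eexp (ENNReal.ofReal (b * M)) := by
      rw [eexp, if_neg ENNReal.ofReal_ne_top, ENNReal.toReal_ofReal (by positivity)]
    rw [hbM, ← eexp_add, ENNReal.ofReal_mul hb.le, ← mul_add]
    exact eexp_mono (mul_le_mul' (ENNReal.ofReal_le_ofReal hcb) hW)
  calc ENNReal.ofReal c * D * eexp (ENNReal.ofReal c * ∫⁻ t in Ioo 0 d, wolffDensity β p σ x t)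
        * eexp (ENNReal.ofReal c * I)
      ≤ ENNReal.ofReal c * D * (eexp (ENNReal.ofReal b * W) * ENNReal.ofReal (Real.exp (b * M)))
        * eexp (ENNReal.ofReal (1 / p * a * β) * I) :=
        mul_le_mul' (mul_le_mul' le_rfl hexp)
          (eexp_mono (mul_le_mul' (ENNReal.ofReal_le_ofReal hca) le_rfl))
    _ = ENNReal.ofReal (c * Real.exp (b * M)) * (D * eexp (ENNReal.ofReal b * W)
        * eexp (ENNReal.ofReal (1 / p * a * β) * I)) := by
        rw [ENNReal.ofReal_mul hc.le]; ring
    _ ≤ ENNReal.ofReal (b * (a ^ (1 / p) * (2:ℝ) ^ (-(β / p)))) * (D * eexp (ENNReal.ofReal b * W)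
        * eexp (ENNReal.ofReal (1 / p * a * β) * I)) :=
        mul_le_mul' (ENNReal.ofReal_le_ofReal ((le_div_iff₀ (Real.exp_pos _)).mp hce)) le_rfl
    _ = ENNReal.ofReal b * (K * eexp (ENNReal.ofReal b * W)) := by
        rw [hK, ENNReal.ofReal_mul hb.le]; ring

end LowerBound

/-- Theorem `genlowbd`: if `u ≥ C₀ 𝒩 u + C₀ |x-x₀|^{(αs-n)/(s-1)}` pointwise,
then there is `c = c(n,α,s,C₀) > 0` with
`u(x) ≥ c |x-x₀|^{(αs-n)/(s-1)} exp(c W^{|x-x₀|}_{α,s}σ(x)) exp(c I^{|x-x₀|}σ(x₀))`. -/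
theorem statement5 (n : ℕ) (hn : 2 ≤ n) (α s C₀ : ℝ) (hs : 1 < s) (hα : 0 < α)
    (hαs : α * s < n) (hC₀ : 0 < C₀) :
    ∃ c : ℝ, 0 < c ∧
      ∀ σ : Measure (En n), IsLocallyFiniteMeasure σ →
        ∀ (x₀ : En n) (u : En n → ℝ≥0∞), Measurable u →
          (∀ x : En n,
            ENNReal.ofReal C₀ * Nop n α s σ u x
              + ENNReal.ofReal C₀ * (ENNReal.ofReal ‖x - x₀‖) ^ ((α*s-(n:ℝ))/(s-1)) ≤ u x) →
          ∀ x : En n,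
            ENNReal.ofReal c * (ENNReal.ofReal ‖x - x₀‖) ^ ((α*s-(n:ℝ))/(s-1))
                * eexp (ENNReal.ofReal c * wolffT n α s σ ‖x - x₀‖ x)
                * eexp (ENNReal.ofReal c * rieszT n α s σ ‖x - x₀‖ x₀)
              ≤ u x := by
  have hβ : 0 < (n:ℝ) - α * s := by linarith
  have hp : 0 < s - 1 := by linarith
  have hexp : (α * s - (n:ℝ)) / (s - 1) = -(((n:ℝ) - α * s) / (s - 1)) := by
    rw [← neg_div, neg_sub]
  obtain ⟨c, hc, h⟩ := exists_lower_bound (E := En n) hβ hp hC₀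
  refine ⟨c, hc, fun σ _ x₀ u hum hu x => ?_⟩
  have hN : ∀ y, Nop n α s σ u y = wolffOp ((n:ℝ) - α * s) (s - 1) σ u y := by
    intro y
    rw [Nop, wolffOp, neg_sub]
  rw [hexp, ← dist_eq_norm]
  refine h σ x₀ u hum (fun y => ?_) x
  rw [← hN, ← hexp, dist_eq_norm]
  exact hu y
end
end
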